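/- arXiv:1412.0080 — 3 statements merged into one kernel-verified Lean document; each statement's English description precedes it below -/
import Mathlib

section
/- Let (X̄,σ̄) be an infinite minimal two-sided shift and let Φ₁, Φ₂ be automorphisms of (X̄,σ̄). Suppose there is a point x̄ ∈ X̄ such that Φ₁(x̄) = ȳ and Φ₂(x̄) = ȳ′, where ȳ and ȳ′ are right asymptotic (or, more generally, their orbits contain right asymptotic points). Then Φ₁ = Φ₂ ∘ σ̄^n for some n ∈ ℤ. -/
/-- The two-sided shift map on `A^ℤ`. -/
def shiftZ {A : Type*} (x : ℤ → A) : ℤ → A := fun n => x (n + 1)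

/-- The `n`-th power of the two-sided shift, `n ∈ ℤ`. -/
def shiftZIter {A : Type*} (n : ℤ) (x : ℤ → A) : ℤ → A := fun m => x (m + n)

/-- The (two-sided) shift orbit of a point. -/
def orbitZ {A : Type*} (x : ℤ → A) : Set (ℤ → A) :=
  Set.range fun n : ℤ => shiftZIter n x

/-- Two points of `A^ℤ` are right asymptotic if they eventually agree to the right. -/
def RightAsymptotic {A : Type*} (x y : ℤ → A) : Prop :=
  ∃ N : ℤ, ∀ n : ℤ, N ≤ n → x n = y n

/-- Minimality of a two-sided shift: every orbit is dense in `X`. -/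
def MinimalZ {A : Type*} [TopologicalSpace A] (X : Set (ℤ → A)) : Prop :=
  ∀ x ∈ X, X ⊆ closure (orbitZ x)

/-- An automorphism of the two-sided shift `(X, σ̄)`: a self-homeomorphism of `X`
commuting with the shift. -/
def IsAutZ {A : Type*} [TopologicalSpace A] (X : Set (ℤ → A)) (Φ : X ≃ₜ X) : Prop :=
  ∀ x y : X, (y : ℤ → A) = shiftZ (x : ℤ → A) → (Φ y : ℤ → A) = shiftZ (Φ x : ℤ → A)

theorem shiftZIter_zero {A : Type*} (x : ℤ → A) : shiftZIter 0 x = x := by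
  funext k
  simp [shiftZIter]

theorem shiftZIter_add {A : Type*} (m n : ℤ) (x : ℤ → A) :
    shiftZIter (m + n) x = shiftZIter m (shiftZIter n x) := by
  funext k
  simp [shiftZIter, add_assoc]

theorem shiftZIter_neg_one_shiftZ {A : Type*} (x : ℤ → A) :
    shiftZIter (-1) (shiftZ x) = x := by
  funext k
  simp [shiftZIter, shiftZ]

theorem shiftZ_shiftZIter_neg_one {A : Type*} (x : ℤ → A) :
    shiftZ (shiftZIter (-1) x) = x := by
  funext k
  simp [shiftZIter, shiftZ]

theorem shiftZIter_mem {A : Type*} {X : Set (ℤ → A)} (hinv : shiftZ '' X = X) (n : ℤ)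
    {x : ℤ → A} (hx : x ∈ X) : shiftZIter n x ∈ X := by
  induction n using Int.induction_on with
  | zero => rwa [shiftZIter_zero]
  | succ i ih =>
    rw [add_comm, shiftZIter_add, ← hinv]
    exact ⟨_, ih, rfl⟩
  | pred i ih =>
    rw [sub_eq_neg_add, shiftZIter_add]
    rw [← hinv] at ih
    obtain ⟨z, hz, hzx⟩ := ih
    rwa [← hzx, shiftZIter_neg_one_shiftZ]

/-- The `n`-th power of the shift, restricted to an invariant set. -/
def shiftOn {A : Type*} {X : Set (ℤ → A)} (hinv : shiftZ '' X = X) (n : ℤ) (x : X) : X :=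
  ⟨shiftZIter n x, shiftZIter_mem hinv n x.2⟩

theorem IsAutZ.map_shiftOn {A : Type*} [TopologicalSpace A] {X : Set (ℤ → A)} {Φ : X ≃ₜ X}
    (hΦ : IsAutZ X Φ) (hinv : shiftZ '' X = X) (n : ℤ) (x : X) :
    (Φ (shiftOn hinv n x) : ℤ → A) = shiftZIter n (Φ x) := by
  induction n using Int.induction_on with
  | zero =>
    have h : shiftOn hinv 0 x = x := Subtype.ext (shiftZIter_zero _)
    rw [h, shiftZIter_zero]
  | succ i ih =>
    have h := hΦ (shiftOn hinv i x) (shiftOn hinv (i + 1) x)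
      (by simp only [shiftOn]; rw [add_comm, shiftZIter_add]; rfl)
    rw [h, ih, add_comm, shiftZIter_add]
    rfl
  | pred i ih =>
    have h := hΦ (shiftOn hinv (-i - 1) x) (shiftOn hinv (-i) x)
      (by simp only [shiftOn]; rw [sub_eq_neg_add, shiftZIter_add, shiftZ_shiftZIter_neg_one])
    rw [sub_eq_neg_add, shiftZIter_add, ← ih, h, ← sub_eq_neg_add, shiftZIter_neg_one_shiftZ]

/-- Closed conditions that each hold eventually along a forward orbit in a two-sided shift hold
simultaneously at some point, namely at an accumulation point of that orbit. -/
theorem exists_forall_mem_of_eventually_shiftOn {A ι : Type*} [Finite A] [TopologicalSpace A]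
    {X : Set (ℤ → A)} (hclosed : IsClosed X) (hinv : shiftZ '' X = X) (x : X)
    {C : ι → Set X} (hC : ∀ i, IsClosed (C i))
    (h : ∀ i, ∀ᶠ k : ℕ in Filter.atTop, shiftOn hinv k x ∈ C i) : ∃ u, ∀ i, u ∈ C i := by
  have : CompactSpace X := isCompact_iff_compactSpace.mp hclosed.isCompact
  let u : ℕ → X := fun k => shiftOn hinv k x
  have hu : Filter.Tendsto u (Filter.hyperfilter ℕ) (nhds ((Filter.hyperfilter ℕ).map u).lim) :=
    Ultrafilter.le_nhds_lim _
  exact ⟨_, fun i => (hC i).mem_of_tendsto hu ((h i).filter_mono Nat.hyperfilter_le_atTop)⟩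

theorem MinimalZ.eq_univ_of_isClosed {A : Type*} [TopologicalSpace A] {X : Set (ℤ → A)}
    (hmin : MinimalZ X) (hinv : shiftZ '' X = X) {E : Set X} (hE : IsClosed E)
    (hEinv : ∀ n, ∀ z ∈ E, shiftOn hinv n z ∈ E) (hne : E.Nonempty) : E = Set.univ := by
  obtain ⟨u, hu⟩ := hne
  refine Set.eq_univ_of_forall fun z => ?_
  have hz : z ∈ closure E := by
    rw [closure_subtype]
    refine closure_mono ?_ (hmin u u.2 z.2)
    rintro _ ⟨n, rfl⟩
    exact ⟨_, hEinv n u hu, rfl⟩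
  rwa [hE.closure_eq] at hz

/-- If two automorphisms of an infinite minimal two-sided shift send
some point `x̄` to points `ȳ`, `ȳ′` whose orbits contain right asymptotic points, then
`Φ₁ = Φ₂ ∘ σ̄ⁿ` for some `n ∈ ℤ`. -/
theorem auts_agreeing_on_RA_classes_differ_by_shift_power
    {A : Type*} [Fintype A] [TopologicalSpace A] [DiscreteTopology A]
    (X : Set (ℤ → A)) (hne : X.Nonempty) (hclosed : IsClosed X)
    (hinv : shiftZ '' X = X)
    (hmin : MinimalZ X) (hinf : X.Infinite)
    (Φ₁ Φ₂ : X ≃ₜ X) (hΦ₁ : IsAutZ X Φ₁) (hΦ₂ : IsAutZ X Φ₂)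
    (x y y' : X) (h₁ : Φ₁ x = y) (h₂ : Φ₂ x = y')
    (hra : ∃ p ∈ orbitZ (y : ℤ → A), ∃ q ∈ orbitZ (y' : ℤ → A), RightAsymptotic p q) :
    ∃ n : ℤ, ∀ z w : X, (w : ℤ → A) = shiftZIter n (z : ℤ → A) →
      (Φ₁ z : ℤ → A) = (Φ₂ w : ℤ → A) := by
  obtain ⟨_, ⟨a, rfl⟩, _, ⟨b, rfl⟩, N, hN⟩ := hra
  subst h₁ h₂
  let C : ℤ → Set X := fun m => {z | (Φ₁ z : ℤ → A) (m + a) = (Φ₂ z : ℤ → A) (m + b)}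
  have hC : ∀ m, IsClosed (C m) := fun m => isClosed_eq
    ((continuous_apply _).comp (continuous_subtype_val.comp Φ₁.continuous))
    ((continuous_apply _).comp (continuous_subtype_val.comp Φ₂.continuous))
  have hu : (⋂ m, C m).Nonempty := by
    obtain ⟨u, hu⟩ := exists_forall_mem_of_eventually_shiftOn hclosed hinv x hC fun m => by
      filter_upwards [Filter.eventually_ge_atTop (N - m).toNat] with k hk
      have h := hN (m + k) (by omega)
      simp only [C, Set.mem_ofPred_eq, hΦ₁.map_shiftOn, hΦ₂.map_shiftOn]
      simpa only [shiftZIter, add_right_comm] using h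
    exact ⟨u, Set.mem_iInter.mpr hu⟩
  have huniv : (⋂ m, C m) = Set.univ := by
    refine hmin.eq_univ_of_isClosed hinv (isClosed_iInter hC) (fun n z hz => ?_) hu
    rw [Set.mem_iInter] at hz ⊢
    intro m
    have h : (Φ₁ z : ℤ → A) (m + n + a) = (Φ₂ z : ℤ → A) (m + n + b) := hz (m + n)
    simp only [C, Set.mem_ofPred_eq, hΦ₁.map_shiftOn, hΦ₂.map_shiftOn]
    simpa only [shiftZIter, add_right_comm] using h
  refine ⟨b - a, fun z w hw => ?_⟩
  obtain rfl : w = shiftOn hinv (b - a) z := Subtype.ext hw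
  have hz : z ∈ ⋂ m, C m := huniv ▸ Set.mem_univ z
  rw [hΦ₂.map_shiftOn]
  funext k
  have h : (Φ₁ z : ℤ → A) (k - a + a) = (Φ₂ z : ℤ → A) (k - a + b) :=
    Set.mem_iInter.mp hz (k - a)
  rw [sub_add_cancel] at h
  rw [h]
  exact congrArg (Φ₂ z : ℤ → A) (by ring)
end

section
/- Let (X,σ) be an infinite minimal one-sided shift whose complexity function satisfies p(n) = n + 1 for all n ≥ 1 (an infinite minimal Sturmian shift). Then Aut(X,σ) consists of only the identity map. -/
/-- The one-sided shift map on `A^ℕ`. -/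
def shiftN {A : Type*} (x : ℕ → A) : ℕ → A := fun n => x (n + 1)

/-- The complexity function: the number of words of length `n` occurring in points of `X`. -/
noncomputable def complexityN {A : Type*} [Fintype A] (X : Set (ℕ → A)) (n : ℕ) : ℕ :=
  Nat.card {w : Fin n → A | ∃ x ∈ X, ∃ i : ℕ, ∀ j : Fin n, w j = x (i + (j : ℕ))}

/-- `X` has sublinear complexity: `p(n) ≤ C n` for all `n ≥ 1`. -/
def SublinearComplexityN {A : Type*} [Fintype A] (X : Set (ℕ → A)) : Prop :=
  ∃ C : ℕ, ∀ n : ℕ, 1 ≤ n → complexityN X n ≤ C * n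

/-- Minimality of a one-sided shift: every forward orbit is dense in `X`. -/
def MinimalN {A : Type*} [TopologicalSpace A] (X : Set (ℕ → A)) : Prop :=
  ∀ x ∈ X, X ⊆ closure {y : ℕ → A | ∃ n : ℕ, y = shiftN^[n] x}
/-- An automorphism of the one-sided shift `(X, σ)`: a continuous bijection of `X`
commuting with the shift. -/
def IsAutN {A : Type*} [TopologicalSpace A] (X : Set (ℕ → A)) (Φ : X → X) : Prop :=
  Continuous Φ ∧ Function.Bijective Φ ∧
    ∀ x y : X, (y : ℕ → A) = shiftN (x : ℕ → A) → (Φ y : ℕ → A) = shiftN (Φ x : ℕ → A)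

theorem iterate_shiftN_apply {A : Type*} (x : ℕ → A) (n k : ℕ) :
    shiftN^[n] x k = x (n + k) := by
  induction n generalizing x with
  | zero => simp
  | succ n ih =>
    rw [Function.iterate_succ_apply, ih]
    exact congrArg x (by omega)

theorem iterate_shiftN_mem {A : Type*} {X : Set (ℕ → A)} (hinv : ∀ x ∈ X, shiftN x ∈ X)
    {x : ℕ → A} (hx : x ∈ X) (n : ℕ) : shiftN^[n] x ∈ X := by
  induction n with
  | zero => simpa
  | succ n ih =>
    rw [Function.iterate_succ_apply']
    exact hinv _ ih

/-- The words of length `n` occurring in points of `X`. -/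
def wordsN {A : Type*} (X : Set (ℕ → A)) (n : ℕ) : Set (Fin n → A) :=
  {w | ∃ x ∈ X, ∃ i : ℕ, ∀ j : Fin n, w j = x (i + (j : ℕ))}

/-- In a shift-invariant set every occurring word is a prefix of a point. -/
theorem exists_prefix_of_mem_wordsN {A : Type*} {X : Set (ℕ → A)}
    (hinv : ∀ x ∈ X, shiftN x ∈ X) {n : ℕ} {w : Fin n → A} (hw : w ∈ wordsN X n) :
    ∃ x ∈ X, ∀ j : Fin n, w j = x j := by
  obtain ⟨x, hx, i, h⟩ := hw
  refine ⟨shiftN^[i] x, iterate_shiftN_mem hinv hx i, fun j => ?_⟩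
  rw [iterate_shiftN_apply, h]

theorem prefix_mem_wordsN {A : Type*} {X : Set (ℕ → A)} {x : ℕ → A} (hx : x ∈ X) (n : ℕ) :
    (fun j : Fin n => x j) ∈ wordsN X n :=
  ⟨x, hx, 0, fun j => by simp⟩

/-- Dropping the first letter of a word. -/
def wordsTailN {A : Type*} (X : Set (ℕ → A)) (n : ℕ) : wordsN X (n + 1) → wordsN X n :=
  fun w => ⟨Fin.tail w.1, by
    obtain ⟨x, hx, i, h⟩ := w.2
    refine ⟨x, hx, i + 1, fun j => ?_⟩
    rw [Fin.tail, h, Fin.val_succ]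
    exact congrArg x (by omega)⟩

/-- In a dense orbit, prefixes recur. -/
theorem MinimalN.exists_prefix_eq {A : Type*} [TopologicalSpace A] [DiscreteTopology A]
    {X : Set (ℕ → A)} (hmin : MinimalN X) {x y : ℕ → A} (hx : x ∈ X) (hy : y ∈ X) (n : ℕ) :
    ∃ m : ℕ, ∀ j < n, y j = x (m + j) := by
  have hopen : IsOpen {z : ℕ → A | ∀ j ∈ Finset.range n, z j = y j} := by
    have : {z : ℕ → A | ∀ j ∈ Finset.range n, z j = y j} =
        ⋂ j ∈ Finset.range n, (fun z : ℕ → A => z j) ⁻¹' {y j} := by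
      ext z; simp
    rw [this]
    exact isOpen_biInter_finset fun j _ => (isOpen_discrete _).preimage (continuous_apply j)
  obtain ⟨z, hz, m, rfl⟩ := mem_closure_iff.1 (hmin x hx hy) _ hopen (fun j _ => rfl)
  refine ⟨m, fun j hj => ?_⟩
  rw [← hz j (Finset.mem_range.2 hj), iterate_shiftN_apply]

theorem wordsTailN_surjective {A : Type*} [TopologicalSpace A] [DiscreteTopology A]
    {X : Set (ℕ → A)} (hinv : ∀ x ∈ X, shiftN x ∈ X) (hmin : MinimalN X) (n : ℕ) :
    Function.Surjective (wordsTailN X n) := by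
  rintro ⟨w, hw⟩
  obtain ⟨y, hy, h⟩ := exists_prefix_of_mem_wordsN hinv hw
  obtain ⟨m, hm⟩ := hmin.exists_prefix_eq (hinv y hy) hy n
  refine ⟨⟨fun j => y (m + j), y, hy, m, fun j => rfl⟩, Subtype.ext (funext fun j => ?_)⟩
  change y (m + (j.succ : ℕ)) = w j
  rw [h, hm j j.2, Fin.val_succ]
  exact congrArg y (by omega)

/-- A surjection between finite types with two nontrivial fibres drops the cardinality by at
least two. -/
theorem Function.Surjective.card_add_two_le {α β : Type*} [Finite α] {f : α → β}
    (hf : Function.Surjective f) {a a' b b' : α} (ha : a ≠ a') (hb : b ≠ b')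
    (haa : f a = f a') (hbb : f b = f b') (hab : f a ≠ f b) :
    Nat.card β + 2 ≤ Nat.card α := by
  have key : ∀ {c c' : α}, c ≠ c' → f c = f c' →
      ∃ d, f d = f c ∧ d ∉ Set.range (Function.surjInv hf) := by
    intro c c' hc hcc
    have hr : ∀ d ∈ Set.range (Function.surjInv hf), d = Function.surjInv hf (f d) := by
      rintro _ ⟨e, rfl⟩
      rw [Function.surjInv_eq hf]
    by_cases h : c ∈ Set.range (Function.surjInv hf)
    · refine ⟨c', hcc.symm, fun h' => hc ?_⟩
      rw [hr c h, hr c' h', hcc]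
    · exact ⟨c, rfl, h⟩
  obtain ⟨d, hd, hdr⟩ := key ha haa
  obtain ⟨e, he, her⟩ := key hb hbb
  have hde : d ≠ e := fun h => hab (by rw [← hd, ← he, h])
  have h1 := Set.ncard_add_ncard_compl (Set.range (Function.surjInv hf))
  have h2 : (Set.range (Function.surjInv hf)).ncard = Nat.card β := by
    rw [← Set.image_univ, Set.ncard_image_of_injective _ (Function.injective_surjInv hf),
      Set.ncard_univ]
  have h3 : ({d, e} : Set α).ncard ≤ (Set.range (Function.surjInv hf))ᶜ.ncard := by
    refine Set.ncard_le_ncard ?_ (Set.toFinite _)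
    rintro z (rfl | rfl)
    · exact hdr
    · exact her
  rw [Set.ncard_pair hde] at h3
  omega

/-- A point of `X` with at least two preimages under the shift. -/
def IsBranchPointN {A : Type*} (X : Set (ℕ → A)) (z : ℕ → A) : Prop :=
  ∃ x ∈ X, ∃ y ∈ X, x ≠ y ∧ shiftN x = z ∧ shiftN y = z

/-- If some word of each positive length has two left extensions, then `X` has a branch point. -/
theorem exists_isBranchPointN {A : Type*} [Finite A] [TopologicalSpace A] [DiscreteTopology A]
    {X : Set (ℕ → A)} (hclosed : IsClosed X) (hinv : ∀ x ∈ X, shiftN x ∈ X)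
    (h : ∀ n, 1 ≤ n → ¬ Function.Injective (wordsTailN X n)) :
    ∃ z ∈ X, IsBranchPointN X z := by
  let K : ℕ → Set ((ℕ → A) × (ℕ → A)) := fun n =>
    {p | p.1 ∈ X ∧ p.2 ∈ X ∧ p.1 0 ≠ p.2 0 ∧ ∀ j, j < n → p.1 (j + 1) = p.2 (j + 1)}
  have hanti : ∀ n, K (n + 1) ⊆ K n := fun n p hp =>
    ⟨hp.1, hp.2.1, hp.2.2.1, fun j hj => hp.2.2.2 j (by omega)⟩
  have hsucc : ∀ n, (K (n + 1)).Nonempty := by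
    intro n
    have := h (n + 1) (by omega)
    simp only [Function.Injective, not_forall] at this
    obtain ⟨⟨u, hu⟩, ⟨v, hv⟩, huv, hne⟩ := this
    obtain ⟨x, hx, hxu⟩ := exists_prefix_of_mem_wordsN hinv hu
    obtain ⟨y, hy, hyv⟩ := exists_prefix_of_mem_wordsN hinv hv
    have htail : Fin.tail u = Fin.tail v := congrArg Subtype.val huv
    refine ⟨(x, y), hx, hy, fun h0 => hne (Subtype.ext (funext fun j => ?_)), fun j hj => ?_⟩
    · refine Fin.cases ?_ (fun i => congrFun htail i) j
      change u 0 = v 0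
      rw [hxu, hyv]
      exact h0
    · have := congrFun htail ⟨j, hj⟩
      rw [Fin.tail, Fin.tail, hxu, hyv] at this
      simpa using this
  have hK : ∀ n, IsClosed (K n) := by
    intro n
    have hc1 : ∀ j, Continuous fun p : (ℕ → A) × (ℕ → A) => p.1 j :=
      fun j => (continuous_apply j).comp continuous_fst
    have hc2 : ∀ j, Continuous fun p : (ℕ → A) × (ℕ → A) => p.2 j :=
      fun j => (continuous_apply j).comp continuous_snd
    refine (hclosed.preimage continuous_fst).inter
      ((hclosed.preimage continuous_snd).inter (IsClosed.inter ?_ ?_))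
    · exact (isClosed_discrete {q : A × A | q.1 ≠ q.2}).preimage ((hc1 0).prodMk (hc2 0))
    · have : {p : (ℕ → A) × (ℕ → A) | ∀ j, j < n → p.1 (j + 1) = p.2 (j + 1)} =
          ⋂ j, ⋂ (_ : j < n), {p | p.1 (j + 1) = p.2 (j + 1)} := by
        ext p; simp
      change IsClosed {p : (ℕ → A) × (ℕ → A) | ∀ j, j < n → p.1 (j + 1) = p.2 (j + 1)}
      rw [this]
      exact isClosed_iInter fun j => isClosed_iInter fun _ =>
        isClosed_eq (hc1 (j + 1)) (hc2 (j + 1))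
  obtain ⟨⟨x, y⟩, hp⟩ := IsCompact.nonempty_iInter_of_sequence_nonempty_isCompact_isClosed K
    hanti (fun n => (hsucc n).mono (hanti n)) (hK 0).isCompact hK
  rw [Set.mem_iInter] at hp
  obtain ⟨hx, hy, h0, -⟩ := hp 0
  refine ⟨shiftN x, hinv x hx, x, hx, y, hy, fun e => h0 (congrFun e 0), rfl, ?_⟩
  exact funext fun j => ((hp (j + 1)).2.2.2 j (by omega)).symm

/-- The prefixes of a branch point have two left extensions. -/
theorem IsBranchPointN.exists_wordsTailN_eq {A : Type*} {X : Set (ℕ → A)} {z : ℕ → A}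
    (hz : IsBranchPointN X z) (n : ℕ) :
    ∃ u v : wordsN X (n + 1), u ≠ v ∧ wordsTailN X n u = wordsTailN X n v ∧
      ∀ j : Fin n, (wordsTailN X n u).1 j = z j := by
  obtain ⟨x, hx, y, hy, hxy, hxz, hyz⟩ := hz
  refine ⟨⟨_, prefix_mem_wordsN hx _⟩, ⟨_, prefix_mem_wordsN hy _⟩, fun h => hxy ?_,
    Subtype.ext (funext fun j => ?_), fun j => ?_⟩
  · funext k
    cases k with
    | zero => exact congrFun (congrArg Subtype.val h) (0 : Fin (n + 1))
    | succ k => exact congrFun (hxz.trans hyz.symm) k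
  · exact congrFun (hxz.trans hyz.symm) j
  · exact congrFun hxz j

/-- Automorphisms preserve branch points. -/
theorem IsAutN.isBranchPointN {A : Type*} [TopologicalSpace A] {X : Set (ℕ → A)} {Φ : X → X}
    (hΦ : IsAutN X Φ) {z : X} (hz : IsBranchPointN X z) : IsBranchPointN X (Φ z) := by
  obtain ⟨x, hx, y, hy, hxy, hxz, hyz⟩ := hz
  refine ⟨Φ ⟨x, hx⟩, (Φ ⟨x, hx⟩).2, Φ ⟨y, hy⟩, (Φ ⟨y, hy⟩).2, fun h => hxy ?_,
    (hΦ.2.2 ⟨x, hx⟩ z hxz.symm).symm, (hΦ.2.2 ⟨y, hy⟩ z hyz.symm).symm⟩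
  exact congrArg Subtype.val (hΦ.2.1.1 (Subtype.ext h))

/-- An automorphism of a minimal shift with a fixed point is the identity. -/
theorem IsAutN.eq_of_fixed {A : Type*} [TopologicalSpace A] [DiscreteTopology A]
    {X : Set (ℕ → A)} (hclosed : IsClosed X) (hinv : ∀ x ∈ X, shiftN x ∈ X)
    (hmin : MinimalN X) {Φ : X → X} (hΦ : IsAutN X Φ) {z : X} (hz : Φ z = z) (x : X) :
    Φ x = x := by
  have hfix : ∀ n, Φ ⟨shiftN^[n] z, iterate_shiftN_mem hinv z.2 n⟩ =
      ⟨shiftN^[n] z, iterate_shiftN_mem hinv z.2 n⟩ := by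
    intro n
    induction n with
    | zero => exact hz
    | succ n ih =>
      refine Subtype.ext ?_
      rw [hΦ.2.2 ⟨shiftN^[n] z, iterate_shiftN_mem hinv z.2 n⟩ _
        (Function.iterate_succ_apply' _ _ _), ih]
      exact (Function.iterate_succ_apply' _ _ _).symm
  have hC : IsClosed (Subtype.val '' {y : X | Φ y = y}) :=
    hclosed.isClosedEmbedding_subtypeVal.isClosedMap _ (isClosed_eq hΦ.1 continuous_id)
  have hsub : {y : ℕ → A | ∃ n : ℕ, y = shiftN^[n] (z : ℕ → A)} ⊆
      Subtype.val '' {y : X | Φ y = y} := by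
    rintro _ ⟨n, rfl⟩
    exact ⟨_, hfix n, rfl⟩
  obtain ⟨y, hy, hyx⟩ := closure_minimal hsub hC (hmin z z.2 x.2)
  rwa [← Subtype.ext hyx]

/-- The automorphism group of an infinite minimal one-sided Sturmian
shift (complexity `p(n) = n + 1` for all `n ≥ 1`) is trivial. -/
theorem sturmian_one_sided_aut_trivial
    {A : Type*} [Fintype A] [TopologicalSpace A] [DiscreteTopology A]
    (X : Set (ℕ → A)) (hne : X.Nonempty) (hclosed : IsClosed X)
    (hinv : ∀ x ∈ X, shiftN x ∈ X)
    (hmin : MinimalN X) (hinf : X.Infinite)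
    (hstur : ∀ n : ℕ, 1 ≤ n → complexityN X n = n + 1) :
    ∀ Φ : X → X, IsAutN X Φ → ∀ x : X, Φ x = x := by
  intro Φ hΦ x
  have hcard : ∀ n, 1 ≤ n → Nat.card (wordsN X n) = n + 1 := hstur
  obtain ⟨z, hzX, hz⟩ := exists_isBranchPointN hclosed hinv fun n hn hinj => by
    have := Nat.card_le_card_of_injective _ hinj
    rw [hcard n hn, hcard (n + 1) (by omega)] at this
    omega
  refine hΦ.eq_of_fixed hclosed hinv hmin (z := ⟨z, hzX⟩) ?_ x
  by_contra hne'
  obtain ⟨k, hk⟩ := Function.ne_iff.1 fun h => hne' (Subtype.ext h)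
  obtain ⟨u, u', huu, hu, huz⟩ := (hΦ.isBranchPointN (z := ⟨z, hzX⟩) hz).exists_wordsTailN_eq
    (k + 1)
  obtain ⟨v, v', hvv, hv, hvz⟩ := hz.exists_wordsTailN_eq (k + 1)
  have := (wordsTailN_surjective hinv hmin (k + 1)).card_add_two_le huu hvv hu hv fun h =>
    hk <| (huz (Fin.last k)).symm.trans (h ▸ hvz (Fin.last k))
  rw [hcard (k + 1) (by omega), hcard (k + 1 + 1) (by omega)] at this
  omega
end

section
/- Let θ be a primitive substitution on a k-letter alphabet A whose generated two-sided shift (X̄_θ, σ̄) is minimal and infinite. Then every automorphism Φ of (X̄_θ, σ̄) is an at most k²-th root of a power of the shift: there exist an integer m with 1 ≤ m ≤ k² and n ∈ ℤ such that Φ^m = σ̄^n. -/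
/-- The extension of a substitution `θ : A → A⁺` to finite words, by concatenation. -/
def substWord {A : Type*} (θ : A → List A) (w : List A) : List A :=
  (w.map θ).flatten

/-- `θ` is a primitive substitution: some power of `θ` sends every letter to a word
containing every letter. -/
def IsPrimitive {A : Type*} (θ : A → List A) : Prop :=
  ∃ n : ℕ, 1 ≤ n ∧ ∀ a b : A, b ∈ (substWord θ)^[n] [a]

/-- The two-sided shift generated by the substitution `θ`: all bi-infinite sequences each
of whose finite blocks occurs in some `θⁿ(a)`, `n ≥ 1`, `a ∈ A`. -/
def substShift {A : Type*} (θ : A → List A) : Set (ℤ → A) :=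
  {x : ℤ → A | ∀ i : ℤ, ∀ n : ℕ, ∃ m : ℕ, 1 ≤ m ∧ ∃ a : A,
    (List.ofFn fun j : Fin n => x (i + ((j : ℕ) : ℤ))) <:+: (substWord θ)^[m] [a]}

section Words

variable {A : Type*}

theorem substWord_append (θ : A → List A) (u v : List A) :
    substWord θ (u ++ v) = substWord θ u ++ substWord θ v := by
  simp [substWord]

theorem iterate_substWord_append (θ : A → List A) (m : ℕ) (u v : List A) :
    (substWord θ)^[m] (u ++ v) = (substWord θ)^[m] u ++ (substWord θ)^[m] v := by
  induction m generalizing u v with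
  | zero => rfl
  | succ m ih => simp [Function.iterate_succ_apply, substWord_append, ih]

theorem iterate_substWord_nil (θ : A → List A) (m : ℕ) : (substWord θ)^[m] [] = [] := by
  induction m with
  | zero => rfl
  | succ m ih => rw [Function.iterate_succ_apply]; exact ih

theorem iterate_substWord_eq_flatMap (θ : A → List A) (m : ℕ) (w : List A) :
    (substWord θ)^[m] w = w.flatMap fun a => (substWord θ)^[m] [a] := by
  induction w with
  | nil => simp [iterate_substWord_nil]
  | cons a w ih =>
    rw [← List.singleton_append, iterate_substWord_append, ih]
    simp

theorem infix_iterate_substWord (θ : A → List A) (m : ℕ) {u v : List A} (h : u <:+: v) :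
    (substWord θ)^[m] u <:+: (substWord θ)^[m] v := by
  obtain ⟨s, t, rfl⟩ := h
  exact ⟨(substWord θ)^[m] s, (substWord θ)^[m] t, by simp [iterate_substWord_append]⟩

theorem iterate_substWord_ne_nil {θ : A → List A} (hθ : ∀ a, θ a ≠ []) (m : ℕ) {w : List A}
    (hw : w ≠ []) : (substWord θ)^[m] w ≠ [] := by
  induction m generalizing w with
  | zero => exact hw
  | succ m ih =>
    rw [Function.iterate_succ_apply]
    refine ih ?_
    obtain ⟨a, w, rfl⟩ := List.exists_cons_of_ne_nil hw
    simp [substWord, hθ a]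

theorem singleton_infix_of_mem {a : A} {l : List A} (h : a ∈ l) : [a] <:+: l := by
  obtain ⟨s, t, rfl⟩ := List.append_of_mem h
  exact ⟨s, t, by simp⟩

theorem length_flatMap_le (f : A → List A) {B : ℕ} (hB : ∀ a, (f a).length ≤ B) (w : List A) :
    (w.flatMap f).length ≤ w.length * B := by
  induction w with
  | nil => simp
  | cons a w ih =>
    have := hB a
    simp only [List.flatMap_cons, List.length_append, List.length_cons]
    nlinarith

theorem le_mul_length_flatMap (f : A → List A) {B C : ℕ} (hB : ∀ a, B ≤ C * (f a).length)
    (w : List A) : w.length * B ≤ C * (w.flatMap f).length := by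
  induction w with
  | nil => simp
  | cons a w ih =>
    have := hB a
    simp only [List.flatMap_cons, List.length_append, List.length_cons]
    nlinarith

/-- The letter whose image covers a given position of a concatenation. -/
theorem exists_letter_at (f : A → List A) (w : List A) (i : ℕ) (hi : i < (w.flatMap f).length) :
    ∃ w₁ a w₂, w = w₁ ++ a :: w₂ ∧ (w₁.flatMap f).length ≤ i ∧
      i < (w₁.flatMap f).length + (f a).length := by
  induction w generalizing i with
  | nil => simp at hi
  | cons a w ih =>
    by_cases h : i < (f a).length
    · exact ⟨[], a, w, by simp, by simp, by simpa using h⟩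
    · simp only [List.flatMap_cons, List.length_append] at hi
      obtain ⟨w₁, b, w₂, rfl, h₁, h₂⟩ := ih (i - (f a).length) (by omega)
      refine ⟨a :: w₁, b, w₂, by simp, ?_, ?_⟩ <;>
        simp only [List.flatMap_cons, List.length_append] <;> omega

/-- The word `l` occurs in `x` at position `i`. -/
def OccursAt (x : ℤ → A) : ℤ → List A → Prop
  | _, [] => True
  | i, a :: l => x i = a ∧ OccursAt x (i + 1) l

theorem occursAt_append (x : ℤ → A) (i : ℤ) (u v : List A) :
    OccursAt x i (u ++ v) ↔ OccursAt x i u ∧ OccursAt x (i + u.length) v := by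
  induction u generalizing i with
  | nil => simp [OccursAt]
  | cons a u ih =>
    have : i + ((a :: u).length : ℤ) = i + 1 + u.length := by push_cast [List.length_cons]; ring
    simp only [List.cons_append, OccursAt, ih, this, and_assoc]

theorem OccursAt.apply_eq {x y : ℤ → A} {i i' : ℤ} {l : List A} (hx : OccursAt x i l)
    (hy : OccursAt y i' l) {j : ℕ} (hj : j < l.length) : x (i + j) = y (i' + j) := by
  induction l generalizing i i' j with
  | nil => simp at hj
  | cons a l ih =>
    cases j with
    | zero => simpa using hx.1.trans hy.1.symm
    | succ j =>
      have := ih hx.2 hy.2 (j := j) (by simpa using hj)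
      rw [add_assoc, add_assoc, add_comm (1 : ℤ)] at this
      exact_mod_cast this

theorem occursAt_ofFn (x : ℤ → A) (i : ℤ) (n : ℕ) :
    OccursAt x i (List.ofFn fun j : Fin n => x (i + ((j : ℕ) : ℤ))) := by
  induction n generalizing i with
  | zero => simp [OccursAt]
  | succ n ih =>
    rw [List.ofFn_succ]
    refine ⟨by simp, ?_⟩
    convert ih (i + 1) using 4
    simp; ring

theorem OccursAt.eq_of_forall {x y : ℤ → A} {i i' : ℤ} {u v : List A} (hu : OccursAt x i u)
    (hv : OccursAt y i' v) (hl : u.length = v.length)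
    (h : ∀ j : ℕ, j < u.length → x (i + j) = y (i' + j)) : u = v := by
  induction u generalizing i i' v with
  | nil => simpa [eq_comm] using hl
  | cons a u ih =>
    cases v with
    | nil => simp at hl
    | cons b v =>
      have h0 := h 0 (by simp)
      simp only [Nat.cast_zero, add_zero] at h0
      rw [ih hu.2 hv.2 (by simpa using hl) ?_, ← hu.1, ← hv.1, h0]
      intro j hj
      have := h (j + 1) (by simpa using hj)
      push_cast at this
      rwa [add_assoc, add_assoc, add_comm (1 : ℤ)]

theorem OccursAt.of_infix {x : ℤ → A} {i : ℤ} {u v : List A} (hv : OccursAt x i v)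
    (h : u <:+: v) : ∃ d : ℕ, d + u.length ≤ v.length ∧ OccursAt x (i + d) u := by
  obtain ⟨s, t, rfl⟩ := h
  rw [occursAt_append, occursAt_append] at hv
  exact ⟨s.length, by simp, hv.1.2⟩

/-- A word occurring inside an iterate of the substitution `θ` on a letter. -/
def InLanguage (θ : A → List A) (w : List A) : Prop :=
  ∃ m : ℕ, 1 ≤ m ∧ ∃ a : A, w <:+: (substWord θ)^[m] [a]

/-- From level `n₀` on, the image of every letter contains every letter. -/
def PrimitiveFrom (θ : A → List A) (n₀ : ℕ) : Prop :=
  ∀ j, n₀ ≤ j → ∀ a b : A, a ∈ (substWord θ)^[j] [b]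

theorem IsPrimitive.exists_primitiveFrom {θ : A → List A} (hprim : IsPrimitive θ)
    (hθ : ∀ a, θ a ≠ []) : ∃ n₀, PrimitiveFrom θ n₀ := by
  obtain ⟨n₀, -, h⟩ := hprim
  refine ⟨n₀, fun j hj a b => ?_⟩
  obtain ⟨d, rfl⟩ := Nat.exists_eq_add_of_le hj
  rw [Function.iterate_add_apply]
  obtain ⟨c, l, hc⟩ := List.exists_cons_of_ne_nil
    (iterate_substWord_ne_nil hθ d (List.cons_ne_nil b []))
  rw [hc]
  exact (infix_iterate_substWord θ n₀ (singleton_infix_of_mem (a := c) (l := c :: l)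
    (by simp))).subset (h c a)

theorem PrimitiveFrom.infix_iterate {θ : A → List A} {n₀ : ℕ} (hp : PrimitiveFrom θ n₀)
    (m j : ℕ) (hj : n₀ ≤ j) (a b : A) :
    (substWord θ)^[m] [a] <:+: (substWord θ)^[m + j] [b] := by
  rw [Function.iterate_add_apply]
  exact infix_iterate_substWord θ m (singleton_infix_of_mem (hp j hj a b))

theorem InLanguage.eventually_infix {θ : A → List A} {n₀ : ℕ} (hp : PrimitiveFrom θ n₀)
    {w : List A} (hw : InLanguage θ w) :
    ∃ c, ∀ c', c ≤ c' → ∀ b, w <:+: (substWord θ)^[c'] [b] := by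
  obtain ⟨m, -, a, h⟩ := hw
  refine ⟨m + n₀, fun c' hc' b => h.trans ?_⟩
  obtain ⟨d, rfl⟩ := Nat.exists_eq_add_of_le hc'
  rw [add_assoc]
  exact hp.infix_iterate m (n₀ + d) (by omega) a b

theorem exists_level_forall_infix {θ : A → List A} {n₀ : ℕ} (hp : PrimitiveFrom θ n₀)
    {F : Set (List A)} (hF : F.Finite) (hL : ∀ w ∈ F, InLanguage θ w) :
    ∃ c, ∀ w ∈ F, ∀ b, w <:+: (substWord θ)^[c] [b] := by
  have h : ∀ w, ∃ c, w ∈ F → ∀ c', c ≤ c' → ∀ b, w <:+: (substWord θ)^[c'] [b] := fun w => by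
    by_cases hw : w ∈ F
    · exact ((hL w hw).eventually_infix hp).imp fun c hc _ => hc
    · exact ⟨0, fun h => absurd h hw⟩
  choose c hc using h
  refine ⟨hF.toFinset.sup c, fun w hw b => hc w hw _ ?_ b⟩
  exact Finset.le_sup (by simpa using hw)

end Words

section Subshift

variable {A : Type*}

theorem exists_append_of_append_eq {pre blk post u v t : List A}
    (h : pre ++ blk ++ post = u ++ v ++ t) (h₁ : u.length ≤ pre.length)
    (h₂ : pre.length + blk.length ≤ u.length + v.length) :
    ∃ s s', v = s ++ blk ++ s' ∧ u.length + s.length = pre.length := by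
  obtain ⟨s, rfl⟩ : u <+: pre :=
    List.prefix_of_prefix_length_le (l₃ := pre ++ blk ++ post)
      (by rw [h, List.append_assoc]; exact List.prefix_append _ _)
      (by rw [List.append_assoc]; exact List.prefix_append _ _) h₁
  have h' : s ++ blk ++ post = v ++ t := by simpa using h
  obtain ⟨s', rfl⟩ : s ++ blk <+: v :=
    List.prefix_of_prefix_length_le (l₃ := s ++ blk ++ post) (List.prefix_append _ _)
      (by rw [h']; exact List.prefix_append _ _)
      (by simp only [List.length_append] at h₂ ⊢; omega)
  exact ⟨s, s', rfl, by simp⟩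

/-- The block of length `n` of `x` at position `i`. -/
abbrev blockZ (x : ℤ → A) (i : ℤ) (n : ℕ) : List A :=
  List.ofFn fun j : Fin n => x (i + ((j : ℕ) : ℤ))

theorem InLanguage.of_infix {θ : A → List A} {u w : List A} (hw : InLanguage θ w)
    (h : u <:+: w) : InLanguage θ u := by
  obtain ⟨m, hm, a, hwa⟩ := hw
  exact ⟨m, hm, a, h.trans hwa⟩

theorem InLanguage.exists_infix_iterate {θ : A → List A} {n₀ : ℕ} (hp : PrimitiveFrom θ n₀)
    {u : List A} (hu : InLanguage θ u) (j : ℕ) :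
    ∃ w, InLanguage θ w ∧ u <:+: (substWord θ)^[j] w := by
  obtain ⟨m, hm, a, h⟩ := hu
  refine ⟨(substWord θ)^[m + n₀] [a], ⟨m + n₀, by omega, a, List.infix_rfl⟩, ?_⟩
  rw [← Function.iterate_add_apply, add_left_comm]
  exact h.trans (hp.infix_iterate m (j + n₀) (by omega) a a)

theorem shiftZIter_mem_substShift {θ : A → List A} {x : ℤ → A} (hx : x ∈ substShift θ) (n : ℤ) :
    shiftZIter n x ∈ substShift θ := fun i l => by
  convert hx (i + n) l using 9
  simp only [shiftZIter]
  congr 1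
  ring

/-- Every block of a point of the shift is read inside the image of a word of the language. -/
theorem exists_occursAt_iterate {θ : A → List A} {n₀ : ℕ} (hp : PrimitiveFrom θ n₀)
    {x : ℤ → A} (hx : x ∈ substShift θ) (j : ℕ) (i : ℤ) (n : ℕ) :
    ∃ w pre blk post, InLanguage θ w ∧
      pre ++ blk ++ post = w.flatMap (fun a => (substWord θ)^[j] [a]) ∧
      blk.length = n ∧ OccursAt x i blk := by
  obtain ⟨w, hw, pre, post, h⟩ := InLanguage.exists_infix_iterate hp (hx i n) j
  exact ⟨w, pre, _, post, hw, by rw [h, iterate_substWord_eq_flatMap], List.length_ofFn,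
    occursAt_ofFn x i n⟩

theorem OccursAt.of_append_eq {x : ℤ → A} {i : ℤ} {pre blk post u v t : List A}
    (hx : OccursAt x i blk) (h : u ++ v ++ t = pre ++ blk ++ post) {d : ℕ}
    (h₁ : u.length = pre.length + d) (h₂ : d + v.length ≤ blk.length) :
    OccursAt x (i + d) v := by
  obtain ⟨s, s', rfl, hs⟩ := exists_append_of_append_eq h (by omega) (by omega)
  rw [occursAt_append, occursAt_append] at hx
  obtain rfl : s.length = d := by omega
  exact hx.1.2

theorem exists_occursAt_letter {θ : A → List A} {n₀ : ℕ} (hp : PrimitiveFrom θ n₀)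
    {x : ℤ → A} (hx : x ∈ substShift θ) {j B : ℕ} (hB1 : 1 ≤ B)
    (hB : ∀ a, ((substWord θ)^[j] [a]).length ≤ B) (i : ℤ) :
    ∃ (b : A) (d : ℕ), d + ((substWord θ)^[j] [b]).length ≤ 2 * B ∧
      OccursAt x (i + d) ((substWord θ)^[j] [b]) := by
  obtain ⟨w, pre, blk, post, -, hw, hl, ho⟩ := exists_occursAt_iterate hp hx j i (2 * B)
  obtain ⟨w₁, a, w₂, rfl, h₁, h₂⟩ := exists_letter_at _ w pre.length
    (by rw [← hw]; simp only [List.length_append]; omega)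
  have ha := hB a
  cases w₂ with
  | nil =>
    have := congrArg List.length hw
    simp only [List.length_append, List.flatMap_append, List.flatMap_cons, List.flatMap_nil,
      List.length_nil] at this
    omega
  | cons b w₂ =>
    have hb := hB b
    set f := fun a => (substWord θ)^[j] [a] with hf
    have h₂ : pre.length < (w₁.flatMap f).length + (f a).length := h₂
    refine ⟨b, (w₁.flatMap f).length + (f a).length - pre.length, ?_, ?_⟩
    · show _ + (f b).length ≤ _
      have : (f b).length ≤ B := hb
      have : (f a).length ≤ B := ha
      omega
    · refine ho.of_append_eq (u := w₁.flatMap f ++ f a) (t := w₂.flatMap f) (pre := pre)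
        (post := post) ?_ ?_ ?_
      · rw [hw]; simp [hf]
      · simp only [List.length_append]; omega
      · have : (f a).length ≤ B := ha
        omega

/-- The coordinates of `x` around `-1` are covered by the images of consecutive letters. -/
theorem exists_desubstitution {θ : A → List A} {n₀ : ℕ} (hp : PrimitiveFrom θ n₀)
    {x : ℤ → A} (hx : x ∈ substShift θ) {m B : ℕ}
    (hB : ∀ a, ((substWord θ)^[m] [a]).length ≤ B) (r : ℕ) :
    ∃ (v₀ : A) (v : List A) (p : ℕ), v.length = r ∧ p < ((substWord θ)^[m] [v₀]).length ∧
      OccursAt x (-1 - p) ((substWord θ)^[m] (v₀ :: v)) := by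
  obtain ⟨w, pre, blk, post, -, hw, hl, ho⟩ :=
    exists_occursAt_iterate hp hx m (-1 - B) ((r + 2) * B + 2)
  have hl' : blk.length = r * B + 2 * B + 2 := by rw [hl]; ring
  obtain ⟨w₁, v₀, w₂, rfl, h₁, h₂⟩ := exists_letter_at _ w (pre.length + B)
    (by rw [← hw]; simp only [List.length_append]; omega)
  have ha := hB v₀
  have hr : r ≤ w₂.length := by
    by_contra! hlt
    have h := congrArg List.length hw
    have h' := length_flatMap_le _ hB w₂
    simp only [List.length_append, List.flatMap_append, List.flatMap_cons] at h
    have : w₂.length * B ≤ r * B := Nat.mul_le_mul_right _ hlt.le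
    omega
  set f := fun a => (substWord θ)^[m] [a] with hf
  have ha' : (f v₀).length ≤ B := ha
  have h₂ : pre.length + B < (w₁.flatMap f).length + (f v₀).length := h₂
  have hv := length_flatMap_le f hB (w₂.take r)
  rw [List.length_take_of_le hr] at hv
  refine ⟨v₀, w₂.take r, pre.length + B - (w₁.flatMap f).length, by simp [hr], ?_, ?_⟩
  · show _ < (f v₀).length
    omega
  · have := ho.of_append_eq (u := w₁.flatMap f) (v := f v₀ ++ (w₂.take r).flatMap f)
      (t := (w₂.drop r).flatMap f) (pre := pre) (post := post)
      (d := (w₁.flatMap f).length - pre.length) ?_ (by omega)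
      (by simp only [List.length_append]; omega)
    · rw [iterate_substWord_eq_flatMap]
      convert this using 1
      · omega
      · rfl
    · rw [hw, List.append_assoc, List.append_assoc, ← List.flatMap_append, List.take_append_drop]
      simp

theorem InLanguage.exists_infix_pair {θ : A → List A} {n₀ : ℕ} (hp : PrimitiveFrom θ n₀)
    {u : List A} (hu : InLanguage θ u) (hu0 : u ≠ []) {j : ℕ}
    (hj : ∀ a, u.length ≤ ((substWord θ)^[j] [a]).length) :
    ∃ w, InLanguage θ w ∧ w.length ≤ 2 ∧ u <:+: (substWord θ)^[j] w := by
  obtain ⟨w, hw, pre, post, h⟩ := InLanguage.exists_infix_iterate hp hu j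
  have hpos := List.length_pos_of_ne_nil hu0
  rw [iterate_substWord_eq_flatMap] at h
  obtain ⟨w₁, a, w₂, rfl, h₁, h₂⟩ := exists_letter_at _ w pre.length
    (by rw [← h]; simp only [List.length_append]; omega)
  set f := fun a => (substWord θ)^[j] [a] with hf
  cases w₂ with
  | nil =>
    refine ⟨[a], hw.of_infix ⟨w₁, [], by simp⟩, by simp, ?_⟩
    have hlen := congrArg List.length h
    simp only [List.length_append, List.flatMap_append, List.flatMap_cons, List.flatMap_nil,
      List.length_nil] at hlen
    obtain ⟨s, s', hs, -⟩ := exists_append_of_append_eq (pre := pre) (blk := u) (post := post)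
      (u := w₁.flatMap f) (v := f a) (t := []) (by rw [h]; simp) h₁ (by omega)
    exact ⟨s, s', hs.symm⟩
  | cons b w₂ =>
    refine ⟨[a, b], hw.of_infix ⟨w₁, w₂, by simp⟩, by simp, ?_⟩
    have hb : u.length ≤ (f b).length := hj b
    have h₂ : pre.length < (w₁.flatMap f).length + (f a).length := h₂
    obtain ⟨s, s', hs, -⟩ := exists_append_of_append_eq (pre := pre) (blk := u) (post := post)
      (u := w₁.flatMap f) (v := f a ++ f b) (t := w₂.flatMap f) (by rw [h]; simp) h₁
      (by simp only [List.length_append]; omega)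
    rw [iterate_substWord_eq_flatMap]
    exact ⟨s, s', by rw [← hs]; simp [hf]⟩

theorem exists_forall_le_length {θ : A → List A} {n₀ : ℕ} (hp : PrimitiveFrom θ n₀)
    (hne : (substShift θ).Nonempty) (n : ℕ) :
    ∃ t₀, ∀ t, t₀ ≤ t → ∀ b, n ≤ ((substWord θ)^[t] [b]).length := by
  obtain ⟨x, hx⟩ := hne
  obtain ⟨c, hc⟩ := InLanguage.eventually_infix hp (hx 0 n)
  exact ⟨c, fun t ht b => by simpa using (hc t ht b).length_le⟩

end Subshift

section Lengths

variable {A : Type*} [Fintype A]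

/-- The maximal length of the level `m` images of letters. -/
def lenMax (θ : A → List A) (m : ℕ) : ℕ :=
  Finset.univ.sup fun a => ((substWord θ)^[m] [a]).length

theorem length_le_lenMax (θ : A → List A) (m : ℕ) (a : A) :
    ((substWord θ)^[m] [a]).length ≤ lenMax θ m :=
  Finset.le_sup (f := fun a => ((substWord θ)^[m] [a]).length) (Finset.mem_univ a)

theorem lenMax_le {θ : A → List A} {m B : ℕ} (h : ∀ a, ((substWord θ)^[m] [a]).length ≤ B) :
    lenMax θ m ≤ B :=
  Finset.sup_le fun a _ => h a

theorem lenMax_add_le (θ : A → List A) (m c : ℕ) :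
    lenMax θ (m + c) ≤ lenMax θ c * lenMax θ m := by
  refine lenMax_le fun a => ?_
  rw [Function.iterate_add_apply, iterate_substWord_eq_flatMap]
  exact (length_flatMap_le _ (length_le_lenMax θ m) _).trans
    (Nat.mul_le_mul_right _ (length_le_lenMax θ c a))

theorem one_le_lenMax [Nonempty A] {θ : A → List A} (hθ : ∀ a, θ a ≠ []) (m : ℕ) :
    1 ≤ lenMax θ m := by
  obtain ⟨a⟩ := ‹Nonempty A›
  exact (List.length_pos_of_ne_nil (iterate_substWord_ne_nil hθ m (List.cons_ne_nil a []))).trans_le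
    (length_le_lenMax θ m a)

theorem PrimitiveFrom.lenMax_le_length {θ : A → List A} {n₀ : ℕ} (hp : PrimitiveFrom θ n₀)
    (m : ℕ) {j : ℕ} (hj : n₀ ≤ j) (b : A) :
    lenMax θ m ≤ ((substWord θ)^[m + j] [b]).length :=
  lenMax_le fun a => (hp.infix_iterate m j hj a b).length_le

theorem PrimitiveFrom.lenMax_le_mul_length {θ : A → List A} {n₀ : ℕ} (hp : PrimitiveFrom θ n₀)
    {m : ℕ} (hm : n₀ ≤ m) (b : A) :
    lenMax θ m ≤ lenMax θ n₀ * ((substWord θ)^[m] [b]).length := by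
  obtain ⟨d, rfl⟩ := Nat.exists_eq_add_of_le' hm
  exact (lenMax_add_le θ d n₀).trans (Nat.mul_le_mul_left _ (hp.lenMax_le_length d le_rfl b))

theorem exists_occursAt_ge {θ : A → List A} {n₀ : ℕ} (hp : PrimitiveFrom θ n₀)
    (hθ : ∀ a, θ a ≠ []) {x : ℤ → A} (hx : x ∈ substShift θ) {w : List A} (hw : InLanguage θ w)
    (N : ℤ) : ∃ i, N ≤ i ∧ OccursAt x i w := by
  have : Nonempty A := ⟨x 0⟩
  obtain ⟨c, hc⟩ := hw.eventually_infix hp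
  obtain ⟨b, d, -, ho⟩ := exists_occursAt_letter hp hx (one_le_lenMax hθ c) (length_le_lenMax θ c) N
  obtain ⟨d', -, ho'⟩ := ho.of_infix (hc c le_rfl b)
  exact ⟨N + d + d', by omega, ho'⟩

/-- In an infinite substitution shift no point has, on a stretch long compared with the images of
letters at a given level, a period comparable with these images. -/
theorem exists_no_long_period {θ : A → List A} (hθ : ∀ a, θ a ≠ []) {n₀ : ℕ}
    (hp : PrimitiveFrom θ n₀) (hinf : (substShift θ).Infinite) :
    ∃ Q : ℕ, ∀ (m : ℕ), ∀ x ∈ substShift θ, ∀ (c₀ : ℤ) (e : ℕ), 1 ≤ e → e ≤ 2 * lenMax θ m →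
      ¬ ∀ c : ℤ, c₀ ≤ c → c < c₀ + (Q * lenMax θ m : ℕ) → x c = x (c + e) := by
  have hne := hinf.nonempty
  have : Nonempty A := ⟨hne.some 0⟩
  obtain ⟨c', hc'⟩ := exists_forall_le_length hp hne 3
  set c₁ := n₀ + c' with hc₁
  have h3 : ∀ m b, 3 * lenMax θ m ≤ ((substWord θ)^[m + c₁] [b]).length := fun m b => by
    rw [hc₁, ← add_assoc, Function.iterate_add_apply, iterate_substWord_eq_flatMap]
    have := le_mul_length_flatMap (B := lenMax θ m) (C := 1)
      (fun a => (substWord θ)^[m + n₀] [a])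
      (fun a => by simpa using hp.lenMax_le_length m le_rfl a) ((substWord θ)^[c'] [b])
    rw [one_mul] at this
    exact (Nat.mul_le_mul_right _ (hc' c' le_rfl b)).trans this
  obtain ⟨c₂, hc₂⟩ := exists_level_forall_infix hp (F := {w | InLanguage θ w ∧ w.length ≤ 2})
    ((List.finite_length_le A 2).subset fun w hw => hw.2) fun w hw => hw.1
  refine ⟨2 * lenMax θ (c₁ + c₂), fun m x hx c₀ e he1 he hper => hinf ?_⟩
  have hL := one_le_lenMax hθ m
  have hz : ∀ z ∈ substShift θ, ∀ i : ℤ, z i = z (i + e) := fun z hz i => by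
    obtain ⟨w, hwL, hw2, hw⟩ := InLanguage.exists_infix_pair hp (hz i (e + 1))
      (by simp) (j := m + c₁) fun a => by
        have := h3 m a
        simp only [List.length_ofFn]
        omega
    obtain ⟨b, d, hd, ho⟩ := exists_occursAt_letter hp hx (j := m + (c₁ + c₂))
      (B := lenMax θ (c₁ + c₂) * lenMax θ m)
      (Nat.mul_pos (one_le_lenMax hθ _) hL)
      (fun a => (length_le_lenMax θ _ a).trans (lenMax_add_le θ _ _)) c₀
    have hin : blockZ z i (e + 1) <:+: (substWord θ)^[m + (c₁ + c₂)] [b] := by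
      rw [← add_assoc, Function.iterate_add_apply]
      exact hw.trans (infix_iterate_substWord θ _ (hc₂ w ⟨hwL, hw2⟩ b))
    obtain ⟨d', hd', ho'⟩ := ho.of_infix hin
    have e0 := (occursAt_ofFn z i (e + 1)).apply_eq ho' (j := 0) (by simp)
    have e1 := (occursAt_ofFn z i (e + 1)).apply_eq ho' (j := e) (by simp)
    simp only [Nat.cast_zero, add_zero] at e0
    rw [e0, e1]
    simp only [List.length_ofFn] at hd'
    refine hper _ (by omega) ?_
    rw [mul_assoc]
    omega
  refine Set.Finite.of_finite_image
    (f := fun z : ℤ → A => fun j : Fin e => z ((j : ℕ) : ℤ)) (Set.toFinite _) ?_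
  intro z hzX z' hzX' h
  have per : ∀ z ∈ substShift θ, ∀ c : ℤ, z (c % e) = z c := fun y hy c => by
    have hy' : Function.Periodic y (e : ℤ) := fun i => (hz y hy i).symm
    rw [← hy'.int_mul (c / e) (c % e)]
    congr 1
    simpa [mul_comm] using Int.emod_add_mul_ediv c e
  funext c
  rw [← per z hzX, ← per z' hzX']
  have h0 : 0 ≤ c % (e : ℤ) := Int.emod_nonneg _ (by omega)
  have h1 : c % (e : ℤ) < e := Int.emod_lt_of_pos _ (by omega)
  have := congrFun h ⟨(c % (e : ℤ)).toNat, by omega⟩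
  simpa [Int.toNat_of_nonneg h0] using this

end Lengths

section Paths

variable {A : Type*}

theorem take_drop_append {L : List A} {i n : ℕ} (h : i + n ≤ L.length) (X : List A) :
    ((L ++ X).drop i).take n = (L.drop i).take n := by
  rw [List.drop_append_of_le_length (by omega), List.take_append_of_le_length]
  rw [List.length_drop]
  omega

theorem OccursAt.take_drop {x : ℤ → A} {i : ℤ} {L : List A} (h : OccursAt x i L) {d n : ℕ}
    (hn : d + n ≤ L.length) : (L.drop d).take n = blockZ x (i + d) n := by
  have hL : L = L.take d ++ ((L.drop d).take n ++ (L.drop d).drop n) := by simp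
  rw [hL, occursAt_append, occursAt_append, List.length_take_of_le (by omega)] at h
  exact h.2.1.eq_of_forall (occursAt_ofFn x (i + d) n)
    (by simp only [List.length_take, List.length_drop, List.length_ofFn]; omega) fun _ _ => rfl

/-- The letter whose block is entered by a window of length `n` at position `p` of the block
`W a`, when the next block is `W b`. -/
def windowEnd (W : A → List A) (n : ℕ) (a : A) (p : ℕ) (b : A) : A :=
  if p + n ≤ (W a).length then a else b

/-- The window of length `n` described by a position: a block, a place in it, and the letter of
the block where the window ends. -/
def windowAt (W : A → List A) (n : ℕ) (q : A × ℕ × A) : List A :=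
  ((W q.1 ++ W q.2.2).drop q.2.1).take n

/-- The position reached at time `i` when reading the concatenation of the blocks of
`s ++ [u₀, u₁]`. -/
def readPos (W : A → List A) (n : ℕ) : List A → A → A → ℕ → A × ℕ × A
  | [], u₀, u₁, i => (u₀, i, windowEnd W n u₀ i u₁)
  | a :: s, u₀, u₁, i =>
    if i < (W a).length then (a, i, windowEnd W n a i (s.headD u₀))
    else readPos W n s u₀ u₁ (i - (W a).length)

section Read

variable {W : A → List A} {n : ℕ}

theorem windowEnd_zero (hW : ∀ a, n ≤ (W a).length) (a b : A) : windowEnd W n a 0 b = a := by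
  simp [windowEnd, hW a]

theorem windowAt_windowEnd (hW : ∀ a, n ≤ (W a).length) (a b : A) {i : ℕ}
    (hi : i ≤ (W a).length) (X : List A) :
    windowAt W n (a, i, windowEnd W n a i b) = ((W a ++ W b ++ X).drop i).take n := by
  have := hW b
  simp only [windowAt, windowEnd]
  split_ifs with h
  · rw [List.append_assoc, take_drop_append h, take_drop_append h]
  · exact (take_drop_append (by simp only [List.length_append]; omega) X).symm

theorem readPos_zero (hW : ∀ a, n ≤ (W a).length) (hn : 1 ≤ n) (s : List A) (u₀ u₁ : A) :
    readPos W n s u₀ u₁ 0 = (s.headD u₀, 0, s.headD u₀) := by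
  cases s with
  | nil => simp [readPos, windowEnd_zero hW]
  | cons a s =>
    have : 0 < (W a).length := hn.trans (hW a)
    simp only [readPos, if_pos this, windowEnd_zero hW, List.headD_cons]

theorem readPos_length (hW : ∀ a, n ≤ (W a).length) (s : List A) (u₀ u₁ : A) :
    readPos W n s u₀ u₁ (s.flatMap W).length = (u₀, 0, u₀) := by
  induction s with
  | nil => simp [readPos, windowEnd_zero hW]
  | cons a s ih =>
    rw [List.flatMap_cons, List.length_append, readPos, if_neg (by omega), Nat.add_sub_cancel_left,
      ih]

theorem windowAt_readPos (hW : ∀ a, n ≤ (W a).length) (s : List A) (u₀ u₁ : A)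
    {i : ℕ} (hi : i ≤ (s.flatMap W).length) :
    windowAt W n (readPos W n s u₀ u₁ i) = (((s ++ [u₀, u₁]).flatMap W).drop i).take n := by
  induction s generalizing i with
  | nil =>
    rw [readPos, windowAt_windowEnd hW u₀ u₁ (by simp at hi; omega) []]
    simp
  | cons a s ih =>
    rw [readPos]
    split_ifs with h
    · rw [windowAt_windowEnd hW a _ h.le ((((s ++ [u₀, u₁]).tail)).flatMap W)]
      cases s <;> simp
    · simp only [List.flatMap_cons, List.length_append] at hi
      rw [ih (by omega), List.cons_append, List.flatMap_cons, List.drop_append,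
        List.drop_eq_nil_of_le (by omega : (W a).length ≤ i), List.nil_append]

end Read

variable [Fintype A] [DecidableEq A]

/-- Transitions from the end of a block to the beginning of the next one. -/
def jumpEdges (W : A → List A) (n : ℕ) : Finset ((A × ℕ × A) × (A × ℕ × A)) :=
  (Finset.univ : Finset (A × A)).image fun c =>
    ((c.1, (W c.1).length - 1, windowEnd W n c.1 ((W c.1).length - 1) c.2), (c.2, 0, c.2))

/-- Transitions inside a block. -/
def innerEdges (W : A → List A) (n : ℕ) : Finset ((A × ℕ × A) × (A × ℕ × A)) :=
  (Finset.univ : Finset (A × A)).biUnion fun c =>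
    (Finset.range ((W c.1).length - 1)).image fun p =>
      ((c.1, p, windowEnd W n c.1 p c.2), (c.1, p + 1, windowEnd W n c.1 (p + 1) c.2))

theorem mem_innerEdges (W : A → List A) (n : ℕ) (a b : A) {p : ℕ} (h : p + 1 < (W a).length) :
    ((a, p, windowEnd W n a p b), (a, p + 1, windowEnd W n a (p + 1) b)) ∈ innerEdges W n :=
  Finset.mem_biUnion.2 ⟨(a, b), Finset.mem_univ _,
    Finset.mem_image.2 ⟨p, Finset.mem_range.2 (by dsimp only; omega), rfl⟩⟩

theorem mem_jumpEdges (W : A → List A) (n : ℕ) (a b : A) :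
    ((a, (W a).length - 1, windowEnd W n a ((W a).length - 1) b), (b, 0, b)) ∈ jumpEdges W n :=
  Finset.mem_image.2 ⟨(a, b), Finset.mem_univ _, rfl⟩

theorem card_edges_le (W : A → List A) (n : ℕ) :
    (jumpEdges W n ∪ innerEdges W n).card ≤
      Fintype.card A ^ 2 + ((jumpEdges W n ∪ innerEdges W n).image Prod.snd).card := by
  have hJ : (jumpEdges W n).card ≤ Fintype.card A ^ 2 :=
    Finset.card_image_le.trans (by rw [Finset.card_univ, Fintype.card_prod, sq])
  have hI : (innerEdges W n).card = ((innerEdges W n).image Prod.snd).card := by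
    refine (Finset.card_image_of_injOn fun e he e' he' h => ?_).symm
    simp only [innerEdges, Finset.coe_biUnion, Set.mem_iUnion, Finset.coe_image, Set.mem_image,
      Finset.mem_coe, Finset.mem_univ] at he he'
    obtain ⟨⟨a, b⟩, -, p, -, rfl⟩ := he
    obtain ⟨⟨a', b'⟩, -, p', -, rfl⟩ := he'
    simp only [Prod.mk.injEq, Nat.add_right_cancel_iff] at h
    obtain ⟨rfl, rfl, h⟩ := h
    simp only [windowEnd] at h ⊢
    grind
  have hsub : (innerEdges W n).image Prod.snd ⊆
      (jumpEdges W n ∪ innerEdges W n).image Prod.snd :=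
    Finset.image_subset_image Finset.subset_union_right
  have := Finset.card_le_card hsub
  have := Finset.card_union_le (jumpEdges W n) (innerEdges W n)
  omega

theorem readPos_edge {W : A → List A} {n : ℕ} (hW : ∀ a, n ≤ (W a).length) (hn : 1 ≤ n)
    (s : List A) (u₀ u₁ : A) {i : ℕ} (hi : i < (s.flatMap W).length) :
    (readPos W n s u₀ u₁ i, readPos W n s u₀ u₁ (i + 1)) ∈ jumpEdges W n ∪ innerEdges W n := by
  induction s generalizing i with
  | nil => simp at hi
  | cons a s ih =>
    simp only [List.flatMap_cons, List.length_append] at hi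
    rcases lt_trichotomy (i + 1) (W a).length with h | h | h
    · simp only [readPos, if_pos h, if_pos (show i < (W a).length by omega)]
      exact Finset.mem_union_right _ (mem_innerEdges W n a _ h)
    · simp only [readPos, h, lt_irrefl, if_false, if_pos (show i < (W a).length by omega),
        Nat.sub_self, readPos_zero hW hn]
      obtain rfl : i = (W a).length - 1 := by omega
      exact Finset.mem_union_left _ (mem_jumpEdges W n a _)
    · simp only [readPos, if_neg (show ¬ i + 1 < (W a).length by omega),
        if_neg (show ¬ i < (W a).length by omega)]
      rw [show i + 1 - (W a).length = i - (W a).length + 1 by omega]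
      exact ih (by omega)

end Paths

/-- Paths in a finite directed graph that end together, read the same observations after the first
step but start with different ones, have to meet at vertices with two incoming edges.  Merging
vertices with equal observations and a common successor does not increase the excess of edges over
vertices, so the excess bounds the number of such pairs of paths. -/
theorem card_add_card_image_snd_le {α β ι : Type*} [DecidableEq α] [Fintype ι] (obs : α → β)
    (E : Finset (α × α)) (P Q : ι → ℕ → α) (M : ι → ℕ) (hM : ∀ i, 1 ≤ M i)
    (hP : ∀ i, ∀ m < M i, (P i m, P i (m + 1)) ∈ E)
    (hQ : ∀ i, ∀ m < M i, (Q i m, Q i (m + 1)) ∈ E)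
    (hend : ∀ i, P i (M i) = Q i (M i)) (hstart : ∀ i, obs (P i 0) ≠ obs (Q i 0))
    (hobs : ∀ i m, 1 ≤ m → m ≤ M i → obs (P i m) = obs (Q i m))
    (hinj : ∀ i j, i ≠ j → obs (P i 1) ≠ obs (P j 1)) :
    Fintype.card ι + (E.image Prod.snd).card ≤ E.card := by
  induction hN : E.card using Nat.strong_induction_on generalizing E P Q with
  | _ N ih =>
  subst hN
  by_cases hco : ∀ p q v, (p, v) ∈ E → (q, v) ∈ E → obs p = obs q → p = q
  · have hback : ∀ i d, d + 1 ≤ M i → P i (M i - d) = Q i (M i - d) := by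
      intro i d
      induction d with
      | zero => intro _; simpa using hend i
      | succ d ihd =>
        intro hd
        have e : M i - (d + 1) + 1 = M i - d := by omega
        have h1 := hP i (M i - (d + 1)) (by omega)
        have h2 := hQ i (M i - (d + 1)) (by omega)
        rw [e] at h1 h2
        rw [ihd (by omega)] at h1
        exact hco _ _ _ h1 h2 (hobs i _ (by omega) (by omega))
    have h1 : ∀ i, P i 1 = Q i 1 := fun i => by
      have := hback i (M i - 1) (by have := hM i; omega)
      rwa [Nat.sub_sub_self (hM i)] at this
    set g : ι → α × α := fun i => (Q i 0, Q i 1)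
    have ginj : Function.Injective g := fun i j hij => by
      by_contra hne
      apply hinj i j hne
      have e : Q i 1 = Q j 1 := congrArg Prod.snd hij
      rw [h1, h1, e]
    have gE : Finset.univ.image g ⊆ E := by
      intro e he
      obtain ⟨i, -, rfl⟩ := Finset.mem_image.1 he
      exact hQ i 0 (hM i)
    have hsub : E.image Prod.snd ⊆ (E \ Finset.univ.image g).image Prod.snd := by
      intro v hv
      obtain ⟨e, he, rfl⟩ := Finset.mem_image.1 hv
      by_cases heg : e ∈ Finset.univ.image g
      · obtain ⟨i, -, rfl⟩ := Finset.mem_image.1 heg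
        refine Finset.mem_image.2 ⟨(P i 0, P i 1), ?_, h1 i⟩
        refine Finset.mem_sdiff.2 ⟨hP i 0 (hM i), fun hmem => ?_⟩
        obtain ⟨j, -, hj⟩ := Finset.mem_image.1 hmem
        by_cases hij : j = i
        · subst hij
          have e : Q j 0 = P j 0 := congrArg Prod.fst hj
          exact hstart j (by rw [e])
        · apply hinj j i hij
          have e : Q j 1 = P i 1 := congrArg Prod.snd hj
          rw [h1 j, e]
      · exact Finset.mem_image_of_mem _ (Finset.mem_sdiff.2 ⟨he, heg⟩)
    have hc := (Finset.card_le_card hsub).trans Finset.card_image_le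
    rw [Finset.card_sdiff_of_subset gE, Finset.card_image_of_injective _ ginj,
      Finset.card_univ] at hc
    have := Finset.card_le_card gE
    rw [Finset.card_image_of_injective _ ginj, Finset.card_univ] at this
    omega
  · push Not at hco
    obtain ⟨p, q, v, hp, hq, hpq, hne⟩ := hco
    set f : α → α := Function.update id q p with hf
    have hfo : ∀ a, obs (f a) = obs a := fun a => by
      by_cases h : a = q
      · simp [hf, h, hpq]
      · simp [hf, h]
    have hlt : (E.image (Prod.map f f)).card < E.card := by
      refine lt_of_le_of_ne Finset.card_image_le fun h => hne ?_
      have := Finset.card_image_iff.1 h hp hq (by simp [hf, hne])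
      exact (Prod.ext_iff.1 this).1
    have key := ih _ hlt (E.image (Prod.map f f)) (fun i m => f (P i m)) (fun i m => f (Q i m))
      (fun i m hm => Finset.mem_image.2 ⟨_, hP i m hm, rfl⟩)
      (fun i m hm => Finset.mem_image.2 ⟨_, hQ i m hm, rfl⟩)
      (fun i => congrArg f (hend i)) (fun i => by simpa only [hfo] using hstart i)
      (fun i m => by simpa only [hfo] using hobs i m)
      (fun i j hij => by simpa only [hfo] using hinj i j hij) rfl
    have hV : (E.image Prod.snd).erase q ⊆ (E.image (Prod.map f f)).image Prod.snd := by
      intro a ha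
      obtain ⟨haq, ha⟩ := Finset.mem_erase.1 ha
      obtain ⟨e, he, rfl⟩ := Finset.mem_image.1 ha
      refine Finset.mem_image.2 ⟨Prod.map f f e, Finset.mem_image_of_mem _ he, ?_⟩
      simp [hf, haq]
    have h1 := Finset.card_le_card hV
    have h2 := Finset.pred_card_le_card_erase (s := E.image Prod.snd) (a := q)
    omega

section AsymptoticPairs

variable {A : Type*}

theorem not_lt_of_no_long_period {B Q : ℕ} {x y : ℤ → A} (hxy : ∀ c : ℤ, 0 ≤ c → x c = y c)
    (hper : ∀ (c₀ : ℤ) (e : ℕ), 1 ≤ e → e ≤ 2 * B →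
      ¬ ∀ c : ℤ, c₀ ≤ c → c < c₀ + (Q * B : ℕ) → x c = x (c + e))
    {Z : List A} (hZ : (Q + 2) * B ≤ Z.length) {M M' : ℤ} (hx : OccursAt x M Z)
    (hy : OccursAt y M' Z) (hM : -B ≤ M) (hM' : M' ≤ B) : ¬ M < M' := fun hlt => by
  refine hper (M + B) (M' - M).toNat (by omega) (by omega) fun c h₁ h₂ => ?_
  have hZ' : Q * B + 2 * B ≤ Z.length := by rwa [← add_mul]
  have h := hx.apply_eq hy (j := (c - M).toNat) (by omega)
  rw [show M + ((c - M).toNat : ℤ) = c by omega, ← hxy _ (by omega)] at h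
  rw [h]
  congr 1
  omega

theorem OccursAt.drop {x : ℤ → A} {i : ℤ} {L : List A} (h : OccursAt x i L) {d : ℕ}
    (hd : d ≤ L.length) : OccursAt x (i + d) (L.drop d) := by
  rw [← List.take_append_drop d L, occursAt_append, List.length_take_of_le hd] at h
  exact h.2

/-- The part to the right of coordinate `-1` of a desubstituted window is long. -/
theorem length_drop_iterate {θ : A → List A} (hθ : ∀ a, θ a ≠ []) {m τ B C : ℕ}
    (hC : ∀ a, B ≤ C * ((substWord θ)^[τ + m] [a]).length) {v₀ : A} {v : List A} {p : ℕ}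
    (hp : p < ((substWord θ)^[m] [v₀]).length) :
    v.length ≤ (((substWord θ)^[m] (v₀ :: v)).drop (p + 1)).length ∧
    v.length * B ≤
      C * ((substWord θ)^[τ] (((substWord θ)^[m] (v₀ :: v)).drop (p + 1))).length ∧
    ((substWord θ)^[τ] (((substWord θ)^[m] (v₀ :: v)).take (p + 1))).length ≤
      ((substWord θ)^[τ + m] [v₀]).length := by
  have hsplit : (substWord θ)^[m] (v₀ :: v) = (substWord θ)^[m] [v₀] ++ (substWord θ)^[m] v := by
    rw [← iterate_substWord_append, List.singleton_append]
  have h₁ := le_mul_length_flatMap (B := 1) (C := 1) (fun a => (substWord θ)^[m] [a])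
    (fun a => by
      rw [one_mul]
      exact List.length_pos_of_ne_nil (iterate_substWord_ne_nil hθ m (List.cons_ne_nil a []))) v
  have h₂ := le_mul_length_flatMap (fun a => (substWord θ)^[τ + m] [a]) hC v
  rw [← iterate_substWord_eq_flatMap] at h₁ h₂
  rw [hsplit, List.drop_append_of_le_length (by omega), List.take_append_of_le_length (by omega)]
  refine ⟨by simp only [List.length_append]; omega, h₂.trans (Nat.mul_le_mul_left _ ?_), ?_⟩
  · rw [iterate_substWord_append, List.length_append, Function.iterate_add_apply]
    omega
  · rw [Function.iterate_add_apply]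
    exact (infix_iterate_substWord θ τ (List.take_prefix _ _).isInfix).length_le

theorem windowAt_readPos_eq_blockZ {W : A → List A} {n : ℕ} (hW : ∀ a, n ≤ (W a).length)
    {x : ℤ → A} {s : List A} {u₀ u₁ : A} {u : List A} {p : ℕ}
    (h : OccursAt x (-1 - p) ((s ++ u₀ :: u₁ :: u).flatMap W)) {i : ℕ}
    (hi : i + p ≤ (s.flatMap W).length) :
    windowAt W n (readPos W n s u₀ u₁ (i + p)) = blockZ x (-1 + i) n := by
  rw [windowAt_readPos hW s u₀ u₁ hi]
  rw [show s ++ u₀ :: u₁ :: u = s ++ [u₀, u₁] ++ u by simp, List.flatMap_append,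
    occursAt_append] at h
  have := hW u₀
  rw [h.1.take_drop (by simp only [List.flatMap_append, List.flatMap_cons, List.length_append]
                        omega)]
  congr 1
  push_cast
  ring_nf

variable [Fintype A] [DecidableEq A]

/-- Two right asymptotic points with the same desubstitutions at two levels are read by two paths
in the graph of positions which end at a common position. -/
theorem exists_readPaths {θ : A → List A} (hθ : ∀ a, θ a ≠ []) {x y : ℤ → A}
    (hxy : ∀ c : ℤ, 0 ≤ c → x c = y c) (hne : x (-1) ≠ y (-1)) {m τ n B C Q : ℕ}
    (hW : ∀ a, n ≤ ((substWord θ)^[τ] [a]).length) (hn : 1 ≤ n)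
    (hB1 : 1 ≤ B) (hB : ∀ a, ((substWord θ)^[τ + m] [a]).length ≤ B)
    (hC1 : 1 ≤ C) (hC : ∀ a, B ≤ C * ((substWord θ)^[τ + m] [a]).length)
    (hperx : ∀ (c₀ : ℤ) (e : ℕ), 1 ≤ e → e ≤ 2 * B →
      ¬ ∀ c : ℤ, c₀ ≤ c → c < c₀ + (Q * B : ℕ) → x c = x (c + e))
    (hpery : ∀ (c₀ : ℤ) (e : ℕ), 1 ≤ e → e ≤ 2 * B →
      ¬ ∀ c : ℤ, c₀ ≤ c → c < c₀ + (Q * B : ℕ) → y c = y (c + e))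
    {v₀ w₀ : A} {v w : List A} (hv : v.length = (Q + 2) * C) (hw : w.length = (Q + 2) * C)
    {p p' q q' : ℕ} (hp : p < ((substWord θ)^[m] [v₀]).length)
    (hp' : p' < ((substWord θ)^[τ + m] [v₀]).length)
    (hq : q < ((substWord θ)^[m] [w₀]).length)
    (hq' : q' < ((substWord θ)^[τ + m] [w₀]).length)
    (hx : OccursAt x (-1 - p) ((substWord θ)^[m] (v₀ :: v)))
    (hx' : OccursAt x (-1 - p') ((substWord θ)^[τ + m] (v₀ :: v)))
    (hy : OccursAt y (-1 - q) ((substWord θ)^[m] (w₀ :: w)))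
    (hy' : OccursAt y (-1 - q') ((substWord θ)^[τ + m] (w₀ :: w))) :
    ∃ (N : ℕ) (P R : ℕ → A × ℕ × A), 1 ≤ N ∧
      (∀ i < N, (P i, P (i + 1)) ∈ jumpEdges (fun a => (substWord θ)^[τ] [a]) n ∪
        innerEdges (fun a => (substWord θ)^[τ] [a]) n) ∧
      (∀ i < N, (R i, R (i + 1)) ∈ jumpEdges (fun a => (substWord θ)^[τ] [a]) n ∪
        innerEdges (fun a => (substWord θ)^[τ] [a]) n) ∧
      P N = R N ∧
      (∀ i ≤ N, windowAt (fun a => (substWord θ)^[τ] [a]) n (P i) = blockZ x (-1 + i) n) ∧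
      (∀ i ≤ N, windowAt (fun a => (substWord θ)^[τ] [a]) n (R i) = blockZ y (-1 + i) n) := by
  obtain ⟨hx₁, hx₂, hx₃⟩ := length_drop_iterate hθ hC (v := v) hp
  obtain ⟨hy₁, hy₂, hy₃⟩ := length_drop_iterate hθ hC (v := w) hq
  rw [Function.iterate_add_apply] at hx' hy'
  set L := (substWord θ)^[m] (v₀ :: v)
  set L' := (substWord θ)^[m] (w₀ :: w)
  have hr : 2 ≤ (Q + 2) * C := by nlinarith
  have hu₁ : ∀ u : List A, (Q + 2) * C * B ≤ C * u.length → (Q + 2) * B ≤ u.length := by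
    intro u hu
    refine Nat.le_of_mul_le_mul_left ?_ hC1
    calc C * ((Q + 2) * B) = (Q + 2) * C * B := by ring
      _ ≤ _ := hu
  rw [hv] at hx₁ hx₂
  rw [hw] at hy₁ hy₂
  have hx₂ := hu₁ _ hx₂
  have hy₂ := hu₁ _ hy₂
  have hx0 := hx.drop (d := p + 1) (by
    have : 2 ≤ (L.drop (p + 1)).length := hr.trans hx₁
    rw [List.length_drop] at this; omega)
  have hy0 := hy.drop (d := q + 1) (by
    have : 2 ≤ (L'.drop (q + 1)).length := hr.trans hy₁
    rw [List.length_drop] at this; omega)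
  rw [show (-1 - p + (p + 1 : ℕ) : ℤ) = 0 by push_cast; ring] at hx0
  rw [show (-1 - q + (q + 1 : ℕ) : ℤ) = 0 by push_cast; ring] at hy0
  obtain ⟨u, t, t', hut, hut', hu2, huZ⟩ : ∃ u t t', L.drop (p + 1) = u ++ t ∧
      L'.drop (q + 1) = u ++ t' ∧ 2 ≤ u.length ∧
      (Q + 2) * B ≤ ((substWord θ)^[τ] u).length := by
    set K := min (L.drop (p + 1)).length (L'.drop (q + 1)).length with hK
    have hKx : K ≤ (L.drop (p + 1)).length := min_le_left _ _
    have hKy : K ≤ (L'.drop (q + 1)).length := min_le_right _ _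
    have heq : (L.drop (p + 1)).take K = (L'.drop (q + 1)).take K := by
      have h₁ := (List.take_append_drop K (L.drop (p + 1))) ▸ hx0
      have h₂ := (List.take_append_drop K (L'.drop (q + 1))) ▸ hy0
      rw [occursAt_append] at h₁ h₂
      refine h₁.1.eq_of_forall h₂.1 ?_ fun j _ => hxy _ (by omega)
      rw [List.length_take_of_le hKx, List.length_take_of_le hKy]
    refine ⟨(L.drop (p + 1)).take K, (L.drop (p + 1)).drop K, (L'.drop (q + 1)).drop K,
      by simp only [List.take_append_drop], by rw [heq]; simp only [List.take_append_drop],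
      by rw [List.length_take_of_le hKx]; omega, ?_⟩
    rcases min_choice (L.drop (p + 1)).length (L'.drop (q + 1)).length with h | h
    · rwa [hK, h, List.take_length]
    · rwa [heq, hK, h, List.take_length]
  rw [← List.take_append_drop (p + 1) L, hut, ← List.append_assoc, iterate_substWord_append,
    occursAt_append] at hx'
  rw [← List.take_append_drop (q + 1) L', hut', ← List.append_assoc, iterate_substWord_append,
    occursAt_append] at hy'
  replace hx' := hx'.1
  replace hy' := hy'.1
  set s := L.take (p + 1)
  set s' := L'.take (q + 1)
  have hxZ := hx'
  have hyZ := hy'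
  rw [iterate_substWord_append, occursAt_append] at hxZ hyZ
  replace hxZ := hxZ.2
  replace hyZ := hyZ.2
  have hpB := hB v₀
  have hqB := hB w₀
  have hM := lt_trichotomy (-1 - p' + ((substWord θ)^[τ] s).length : ℤ)
    (-1 - q' + ((substWord θ)^[τ] s').length)
  rcases hM with hlt | hM | hgt
  · exact absurd hlt (not_lt_of_no_long_period hxy hperx huZ hxZ hyZ (by omega) (by omega))
  rotate_left
  · exact absurd hgt (not_lt_of_no_long_period (fun c hc => (hxy c hc).symm) hpery huZ hyZ hxZ
      (by omega) (by omega))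
  have hBZ : B + B ≤ ((substWord θ)^[τ] u).length := by nlinarith
  have hM0 : p' + 1 ≤ ((substWord θ)^[τ] s).length := by
    by_contra! hlt
    have h := hxZ.apply_eq hyZ (j := p' - ((substWord θ)^[τ] s).length) (by omega)
    rw [show (-1 - p' + ((substWord θ)^[τ] s).length +
      (p' - ((substWord θ)^[τ] s).length : ℕ) : ℤ) = -1 by omega,
      show (-1 - q' + ((substWord θ)^[τ] s').length +
      (p' - ((substWord θ)^[τ] s).length : ℕ) : ℤ) = -1 by omega] at h
    exact hne h
  obtain ⟨u₀, u₁, u, rfl⟩ : ∃ a b l, u = a :: b :: l := by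
    rcases u with _ | ⟨a, _ | ⟨b, l⟩⟩
    · simp at hu2
    · simp at hu2
    · exact ⟨a, b, l, rfl⟩
  rw [iterate_substWord_eq_flatMap] at hx' hy' hM0
  rw [iterate_substWord_eq_flatMap θ τ s, iterate_substWord_eq_flatMap θ τ s'] at hM
  set W := fun a => (substWord θ)^[τ] [a]
  refine ⟨(s.flatMap W).length - p', fun i => readPos W n s u₀ u₁ (i + p'),
    fun i => readPos W n s' u₀ u₁ (i + q'), by omega, fun i hi => ?_, fun i hi => ?_, ?_,
    fun i hi => windowAt_readPos_eq_blockZ (W := W) hW hx' (by omega),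
    fun i hi => windowAt_readPos_eq_blockZ (W := W) hW hy' (by omega)⟩
  · dsimp only
    rw [add_right_comm]
    exact readPos_edge (W := W) hW hn s u₀ u₁ (by omega)
  · dsimp only
    rw [add_right_comm]
    exact readPos_edge (W := W) hW hn s' u₀ u₁ (by omega)
  · simp only [show (s.flatMap W).length - p' + p' = (s.flatMap W).length by omega,
      show (s.flatMap W).length - p' + q' = (s'.flatMap W).length by omega,
      readPos_length (W := W) hW]

/-- Right asymptotic pairs with pairwise different right tails number at most `k ^ 2`. -/
theorem card_asymptotic_pairs_le {θ : A → List A} (hθ : ∀ a, θ a ≠ []) {n₀ : ℕ}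
    (hp : PrimitiveFrom θ n₀) (hinf : (substShift θ).Infinite) {ι : Type*} [Fintype ι]
    (x y : ι → ℤ → A) (hx : ∀ i, x i ∈ substShift θ) (hy : ∀ i, y i ∈ substShift θ)
    (hxy : ∀ i (c : ℤ), 0 ≤ c → x i c = y i c) (hne : ∀ i, x i (-1) ≠ y i (-1))
    (htail : ∀ i j, i ≠ j → ∃ c : ℤ, 0 ≤ c ∧ x i c ≠ x j c) :
    Fintype.card ι ≤ Fintype.card A ^ 2 := by
  have hnonempty := hinf.nonempty
  have : Nonempty A := ⟨hnonempty.some 0⟩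
  obtain ⟨n, hn, hpre⟩ : ∃ n : ℕ, 1 ≤ n ∧ ∀ i j, i ≠ j → blockZ (x i) 0 n ≠ blockZ (x j) 0 n := by
    have h : ∀ e : ι × ι, ∃ c : ℕ, e.1 ≠ e.2 → x e.1 c ≠ x e.2 c := fun e => by
      by_cases he : e.1 = e.2
      · exact ⟨0, fun h => absurd he h⟩
      · obtain ⟨c, hc, hc'⟩ := htail _ _ he
        exact ⟨c.toNat, fun _ => by rwa [Int.toNat_of_nonneg hc]⟩
    choose c hc using h
    refine ⟨Finset.univ.sup c + 1, by omega, fun i j hij h => hc (i, j) hij ?_⟩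
    have hle : c (i, j) ≤ Finset.univ.sup c := Finset.le_sup (Finset.mem_univ _)
    have := congrFun (List.ofFn_injective h) ⟨c (i, j), by omega⟩
    simpa using this
  obtain ⟨t₀, ht₀⟩ := exists_forall_le_length hp hnonempty n
  obtain ⟨Q, hQ⟩ := exists_no_long_period hθ hp hinf
  set C := lenMax θ n₀
  set lev : ℕ → ℕ := fun q => n₀ + q * (t₀ + 1) with hlev
  choose v₀ v p hvl hpl hvo using fun (q : ℕ) (i : ι) =>
    exists_desubstitution hp (hx i) (length_le_lenMax θ (lev q)) ((Q + 2) * C)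
  choose w₀ w q' hwl hql hwo using fun (q : ℕ) (i : ι) =>
    exists_desubstitution hp (hy i) (length_le_lenMax θ (lev q)) ((Q + 2) * C)
  obtain ⟨k, l, hkl, hpat⟩ : ∃ k l : ℕ, k < l ∧ ∀ i, v₀ k i = v₀ l i ∧ v k i = v l i ∧
      w₀ k i = w₀ l i ∧ w k i = w l i := by
    let pat : ℕ → ι → A × List.Vector A ((Q + 2) * C) × A × List.Vector A ((Q + 2) * C) :=
      fun q i => (v₀ q i, ⟨v q i, hvl q i⟩, w₀ q i, ⟨w q i, hwl q i⟩)
    obtain ⟨k, l, hkl, h⟩ := Finite.exists_ne_map_eq_of_infinite pat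
    have h' : ∀ i, v₀ k i = v₀ l i ∧ v k i = v l i ∧ w₀ k i = w₀ l i ∧ w k i = w l i := fun i => by
      have := congrFun h i
      exact ⟨congrArg Prod.fst this, congrArg (fun z => z.2.1.1) this,
        congrArg (fun z => z.2.2.1) this, congrArg (fun z => z.2.2.2.1) this⟩
    rcases lt_or_gt_of_ne hkl with hlt | hgt
    · exact ⟨k, l, hlt, h'⟩
    · exact ⟨l, k, hgt, fun i => by simp only [h', and_self]⟩
  obtain ⟨d, rfl⟩ : ∃ d, l = k + d + 1 := ⟨l - k - 1, by omega⟩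
  set τ := (d + 1) * (t₀ + 1) with hτ
  have hl : lev (k + d + 1) = τ + lev k := by simp only [hlev, hτ]; ring
  have hlevn : n₀ ≤ τ + lev k := by simp only [hlev]; omega
  have hτt : t₀ ≤ τ := by rw [hτ]; nlinarith
  have paths := fun i => exists_readPaths hθ (hxy i) (hne i) (m := lev k) (τ := τ) (ht₀ τ hτt) hn
    (one_le_lenMax hθ (τ + lev k)) (length_le_lenMax θ (τ + lev k)) (one_le_lenMax hθ n₀)
    (hp.lenMax_le_mul_length hlevn) (hQ (τ + lev k) _ (hx i)) (hQ (τ + lev k) _ (hy i))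
    (hvl k i) (hwl k i) (hpl k i) (by rw [(hpat i).1, ← hl]; exact hpl _ i) (hql k i)
    (by rw [(hpat i).2.2.1, ← hl]; exact hql _ i) (hvo k i)
    (by rw [(hpat i).1, (hpat i).2.1, ← hl]; exact hvo _ i) (hwo k i)
    (by rw [(hpat i).2.2.1, (hpat i).2.2.2, ← hl]; exact hwo _ i)
  choose N P R hN hP hR hend hPx hRy using paths
  have key := card_add_card_image_snd_le (windowAt (fun a => (substWord θ)^[τ] [a]) n) _ P R N hN
    hP hR hend (fun i h => ?_) (fun i j h₁ h₂ => ?_) (fun i j hij h => ?_)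
  · have := card_edges_le (fun a => (substWord θ)^[τ] [a]) n
    omega
  · rw [hPx i 0 (by omega), hRy i 0 (by omega)] at h
    have := congrFun (List.ofFn_injective h) ⟨0, hn⟩
    simp only [Nat.cast_zero, add_zero] at this
    exact hne i this
  · rw [hPx i j h₂, hRy i j h₂]
    exact congrArg _ (funext fun c => hxy i _ (by omega))
  · rw [hPx i 1 (hN i), hPx j 1 (hN j)] at h
    exact hpre i j hij (by simpa using h)

end AsymptoticPairs

section ShiftPowers

variable {A : Type*}

theorem RightAsymptotic.exists_last_ne {x y : ℤ → A} (h : RightAsymptotic x y) (hne : x ≠ y) :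
    ∃ n : ℤ, (∀ c : ℤ, 0 ≤ c → x (c + n) = y (c + n)) ∧ x (-1 + n) ≠ y (-1 + n) := by
  obtain ⟨N, hN⟩ := h
  obtain ⟨b, hb, hmax⟩ := Int.exists_greatest_of_bdd (P := fun c => x c ≠ y c)
    ⟨N, fun c hc => by by_contra! hlt; exact hc (hN c hlt.le)⟩ (Function.ne_iff.1 hne)
  refine ⟨b + 1, fun c hc => ?_, by simpa [add_comm] using hb⟩
  by_contra hc'
  have := hmax _ hc'
  omega

/-- The power `σ ^ n` of the shift on a substitution shift. -/
def shiftPow (θ : A → List A) (n : ℤ) (x : substShift θ) : substShift θ :=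
  ⟨shiftZIter n x, shiftZIter_mem_substShift x.2 n⟩

theorem shiftPow_apply (θ : A → List A) (n : ℤ) (x : substShift θ) (c : ℤ) :
    (shiftPow θ n x : ℤ → A) c = (x : ℤ → A) (c + n) := rfl

theorem shiftPow_shiftPow (θ : A → List A) (n m : ℤ) (x : substShift θ) :
    shiftPow θ n (shiftPow θ m x) = shiftPow θ (n + m) x :=
  Subtype.ext (funext fun c => congrArg (x : ℤ → A) (add_assoc c n m))

theorem shiftPow_zero (θ : A → List A) (x : substShift θ) : shiftPow θ 0 x = x :=
  Subtype.ext (funext fun c => congrArg (x : ℤ → A) (add_zero c))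

variable [TopologicalSpace A]

theorem continuous_shiftPow (θ : A → List A) (n : ℤ) : Continuous (shiftPow θ n) :=
  Continuous.subtype_mk (f := fun x : substShift θ => shiftZIter n (x : ℤ → A))
    (continuous_pi fun c => (continuous_apply (c + n)).comp continuous_subtype_val) _

theorem IsAutZ.commute_shiftPow {θ : A → List A} {Φ : substShift θ ≃ₜ substShift θ}
    (hΦ : IsAutZ (substShift θ) Φ) (n : ℤ) : Function.Commute Φ (shiftPow θ n) := by
  have h1 : Function.Commute Φ (shiftPow θ 1) := fun x =>
    Subtype.ext (hΦ x (shiftPow θ 1 x) rfl)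
  induction n using Int.induction_on with
  | zero => intro x; rw [shiftPow_zero, shiftPow_zero]
  | succ n ih =>
    intro x
    rw [← shiftPow_shiftPow, ih, h1, shiftPow_shiftPow]
  | pred n ih =>
    intro x
    have h := h1 (shiftPow θ (-n - 1) x)
    rw [shiftPow_shiftPow, add_sub_cancel, ih] at h
    have h' := congrArg (shiftPow θ (-1)) h
    rw [shiftPow_shiftPow, shiftPow_shiftPow, neg_add_cancel, shiftPow_zero] at h'
    rw [← h']
    congr 1
    ring

end ShiftPowers

section Topology

variable {A : Type*} [TopologicalSpace A] [DiscreteTopology A]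

theorem isClosed_substShift (θ : A → List A) : IsClosed (substShift θ) := by
  have : substShift θ = ⋂ (i : ℤ) (n : ℕ), (fun x : ℤ → A => fun j : Fin n => x (i + (j : ℕ))) ⁻¹'
      {b | ∃ m : ℕ, 1 ≤ m ∧ ∃ a : A, List.ofFn b <:+: (substWord θ)^[m] [a]} := by
    ext x
    simp [substShift]
  rw [this]
  exact isClosed_iInter fun i => isClosed_iInter fun n =>
    (isClosed_discrete _).preimage (continuous_pi fun j => continuous_apply _)

variable [Fintype A]

instance substShift.compactSpace (θ : A → List A) : CompactSpace (substShift θ) :=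
  isCompact_iff_compactSpace.1 (isClosed_substShift θ).isCompact

/-- Pairs of points agreeing on larger and larger sets of coordinates accumulate at a pair of
points agreeing on the union of these sets. -/
theorem exists_agree_of_forall_exists_agree {X : Set (ℤ → A)} [CompactSpace X]
    (S : ℕ → Set ℤ) (hS : Monotone S) {D : Set (X × X)} (hD : IsClosed D)
    (h : ∀ N, ∃ e ∈ D, ∀ c ∈ S N, (e.1 : ℤ → A) c = (e.2 : ℤ → A) c) :
    ∃ e ∈ D, ∀ N, ∀ c ∈ S N, (e.1 : ℤ → A) c = (e.2 : ℤ → A) c := by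
  let K : ℕ → Set (X × X) := fun N => D ∩ ⋂ c ∈ S N, {e | (e.1 : ℤ → A) c = (e.2 : ℤ → A) c}
  have hcl : ∀ N, IsClosed (K N) := fun N => hD.inter <| isClosed_biInter fun c _ =>
    isClosed_eq ((continuous_apply c).comp (continuous_subtype_val.comp continuous_fst))
      ((continuous_apply c).comp (continuous_subtype_val.comp continuous_snd))
  obtain ⟨e, he⟩ := IsCompact.nonempty_iInter_of_sequence_nonempty_isCompact_isClosed K
    (fun N e he => ⟨he.1, Set.mem_iInter₂.2 fun c hc =>
      Set.mem_iInter₂.1 he.2 c (hS N.le_succ hc)⟩)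
    (fun N => by
      obtain ⟨e, heD, he⟩ := h N
      exact ⟨e, heD, Set.mem_iInter₂.2 he⟩)
    (hcl 0).isCompact hcl
  rw [Set.mem_iInter] at he
  exact ⟨e, (he 0).1, fun N c hc => Set.mem_iInter₂.1 (he N).2 c hc⟩

/-- A continuous map to a discrete space depends on finitely many coordinates. -/
theorem exists_radius {X : Set (ℤ → A)} [CompactSpace X] {β : Type*} [TopologicalSpace β]
    [DiscreteTopology β] (f : X → β) (hf : Continuous f) :
    ∃ R : ℕ, ∀ x y : X, (∀ c : ℤ, -R ≤ c → c ≤ R → (x : ℤ → A) c = (y : ℤ → A) c) →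
      f x = f y := by
  by_contra! h
  obtain ⟨e, he, hag⟩ := exists_agree_of_forall_exists_agree (X := X)
    (fun N : ℕ => Set.Icc (-N : ℤ) N)
    (fun M N hMN => Set.Icc_subset_Icc (by omega) (by omega))
    (D := (fun e : X × X => (f e.1, f e.2)) ⁻¹' {b | b.1 ≠ b.2})
    ((isClosed_discrete _).preimage (by fun_prop))
    (fun N => by
      obtain ⟨x, y, hxy, hne⟩ := h N
      exact ⟨(x, y), hne, fun c hc => hxy c hc.1 hc.2⟩)
  refine he (congrArg f (Subtype.ext (funext fun c => hag c.natAbs c ⟨?_, ?_⟩))) <;> omega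

/-- Continuous shift commuting maps are determined by the right tail of the image of a point. -/
theorem eq_of_rightAsymptotic {θ : A → List A} {n₀ : ℕ} (hp : PrimitiveFrom θ n₀)
    (hθ : ∀ a, θ a ≠ []) {f g : substShift θ → substShift θ} (hf : Continuous f)
    (hg : Continuous g) (hfT : ∀ n, Function.Commute f (shiftPow θ n))
    (hgT : ∀ n, Function.Commute g (shiftPow θ n)) (x : substShift θ)
    (h : RightAsymptotic (f x : ℤ → A) (g x)) : f = g := by
  obtain ⟨N, hN⟩ := h
  obtain ⟨R, hR⟩ := exists_radius (X := substShift θ)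
    (fun z => ((f z : ℤ → A) 0, (g z : ℤ → A) 0))
    (((continuous_apply 0).comp (continuous_subtype_val.comp hf)).prodMk
      ((continuous_apply 0).comp (continuous_subtype_val.comp hg)))
  have key : ∀ z, (f z : ℤ → A) 0 = (g z : ℤ → A) 0 := fun z => by
    obtain ⟨i, hi, ho⟩ := exists_occursAt_ge hp hθ x.2 (z.2 (-R) (2 * R + 1)) N
    have h0 := hR z (shiftPow θ (i + R) x) fun c h₁ h₂ => by
      have := (occursAt_ofFn (z : ℤ → A) (-R) (2 * R + 1)).apply_eq ho (j := (c + R).toNat)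
        (by rw [List.length_ofFn]; omega)
      rw [shiftPow_apply]
      convert this using 2 <;> omega
    have h₁ := congrArg Prod.fst h0
    have h₂ := congrArg Prod.snd h0
    dsimp only at h₁ h₂
    rw [h₁, h₂, hfT, hgT, shiftPow_apply, shiftPow_apply]
    exact hN _ (by omega)
  funext z
  refine Subtype.ext (funext fun c => ?_)
  have := key (shiftPow θ c z)
  rw [hfT, hgT, shiftPow_apply, shiftPow_apply] at this
  simpa using this

theorem rightAsymptotic_map {θ : A → List A} {f : substShift θ → substShift θ}
    (hf : Continuous f) (hfT : ∀ n, Function.Commute f (shiftPow θ n)) {x y : substShift θ}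
    (h : RightAsymptotic (x : ℤ → A) y) : RightAsymptotic (f x : ℤ → A) (f y) := by
  obtain ⟨N, hN⟩ := h
  obtain ⟨R, hR⟩ := exists_radius (X := substShift θ) (fun z => (f z : ℤ → A) 0)
    ((continuous_apply 0).comp (continuous_subtype_val.comp hf))
  refine ⟨N + R, fun n hn => ?_⟩
  have := hR (shiftPow θ n x) (shiftPow θ n y) fun c h₁ h₂ => hN _ (by omega)
  rw [hfT, hfT, shiftPow_apply, shiftPow_apply] at this
  simpa using this

theorem exists_rightAsymptotic {θ : A → List A} (hinf : (substShift θ).Infinite) :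
    ∃ x y : substShift θ, RightAsymptotic (x : ℤ → A) y ∧ x ≠ y := by
  by_contra! hno
  obtain ⟨n, hn⟩ : ∃ n : ℕ, ∀ x y : substShift θ,
      (∀ c : ℤ, 0 ≤ c → c < n → (x : ℤ → A) c = (y : ℤ → A) c) →
      (x : ℤ → A) (-1) = (y : ℤ → A) (-1) := by
    by_contra! h
    obtain ⟨e, he, hag⟩ := exists_agree_of_forall_exists_agree (X := substShift θ)
      (fun N : ℕ => Set.Ico (0 : ℤ) N) (fun M N hMN => Set.Ico_subset_Ico le_rfl (by omega))
      (D := (fun e => ((e.1 : ℤ → A) (-1), (e.2 : ℤ → A) (-1))) ⁻¹' {b | b.1 ≠ b.2})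
      ((isClosed_discrete _).preimage
        (((continuous_apply _).comp (continuous_subtype_val.comp continuous_fst)).prodMk
          ((continuous_apply _).comp (continuous_subtype_val.comp continuous_snd))))
      (fun N => by
        obtain ⟨x, y, hxy, hne⟩ := h N
        exact ⟨(x, y), hne, fun c hc => hxy c hc.1 hc.2⟩)
    exact he (by
      have := hno e.1 e.2 ⟨0, fun c hc => hag (c.toNat + 1) c ⟨hc, by omega⟩⟩
      simp only [this])
  have hback : ∀ (x y : substShift θ) (J : ℤ),
      (∀ j : Fin n, (x : ℤ → A) (J + (j : ℕ)) = (y : ℤ → A) (J + (j : ℕ))) →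
      ∀ d : ℕ, ∀ c : ℤ, J - d ≤ c → c < J + n → (x : ℤ → A) c = (y : ℤ → A) c := by
    intro x y J h d
    induction d with
    | zero =>
      intro c h₁ h₂
      have := h ⟨(c - J).toNat, by omega⟩
      simpa only [show J + (((c - J).toNat : ℕ) : ℤ) = c by omega] using this
    | succ d ih =>
      intro c h₁ h₂
      by_cases hc : J - d ≤ c
      · exact ih c hc h₂
      · have := hn (shiftPow θ (c + 1) x) (shiftPow θ (c + 1) y) fun c' h₃ h₄ =>
          ih _ (by omega) (by omega)
        simpa [shiftPow_apply] using this
  obtain ⟨s, hsX, hs⟩ := hinf.exists_subset_card_eq (Fintype.card (Fin n → A) + 1)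
  have hsep : ∀ e : (ℤ → A) × (ℤ → A), ∃ c : ℤ, e.1 ≠ e.2 → e.1 c ≠ e.2 c := fun e => by
    by_cases he : e.1 = e.2
    · exact ⟨0, fun h => absurd he h⟩
    · exact (Function.ne_iff.1 he).imp fun c hc _ => hc
  choose sep hsep using hsep
  classical
  obtain ⟨J, hJ⟩ := Finset.exists_le ((s ×ˢ s).image fun e => sep e)
  obtain ⟨x, hx, y, hy, hxy, heq⟩ := Finset.exists_ne_map_eq_of_card_lt_of_maps_to
    (s := s) (t := Finset.univ) (f := fun x : ℤ → A => fun j : Fin n => x (J + 1 + (j : ℕ)))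
    (by rw [hs, Finset.card_univ]; omega) (fun _ _ => Finset.mem_coe.2 (Finset.mem_univ _))
  have hle := hJ _ (Finset.mem_image_of_mem _ (Finset.mk_mem_product hx hy))
  refine hsep (x, y) hxy (hback ⟨x, hsX hx⟩ ⟨y, hsX hy⟩ (J + 1) (congrFun heq)
    (J + 1 - sep (x, y)).toNat _ ?_ ?_) <;> omega

end Topology

/-- Every automorphism of the infinite minimal two-sided shift generated
by a primitive substitution on `k` letters is an at most `k²`-th root of a power of the
shift: `Φ^m = σ̄ⁿ` for some `1 ≤ m ≤ k²` and `n ∈ ℤ`. -/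
theorem primitive_substitution_aut_is_root_of_shift_power
    {A : Type*} [Fintype A] [TopologicalSpace A] [DiscreteTopology A]
    (k : ℕ) (hcard : Fintype.card A = k)
    (θ : A → List A) (hθ : ∀ a : A, θ a ≠ [])
    (hprim : IsPrimitive θ)
    (hmin : MinimalZ (substShift θ)) (hinf : (substShift θ).Infinite)
    (Φ : ↥(substShift θ) ≃ₜ ↥(substShift θ)) (hΦ : IsAutZ (substShift θ) Φ) :
    ∃ m : ℕ, 1 ≤ m ∧ m ≤ k ^ 2 ∧
      ∃ n : ℤ, ∀ x : ↥(substShift θ),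
        ((⇑Φ)^[m] x : ℤ → A) = shiftZIter n (x : ℤ → A) := by
  classical
  obtain ⟨n₀, hp⟩ := hprim.exists_primitiveFrom hθ
  obtain ⟨x, y, hxy, hne⟩ := exists_rightAsymptotic hinf
  have hcont : ∀ i : ℕ, Continuous (⇑Φ)^[i] := fun i => Φ.continuous.iterate i
  have hcomm : ∀ (i : ℕ) (n : ℤ), Function.Commute (⇑Φ)^[i] (shiftPow θ n) := fun i n =>
    (hΦ.commute_shiftPow n).iterate_left i
  choose c hc hc' using fun i : ℕ => (rightAsymptotic_map (hcont i) (hcomm i) hxy).exists_last_ne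
    fun h => hne (Φ.injective.iterate i (Subtype.ext h))
  by_contra! hno
  have htail : ∀ (i j : ℕ), i < j → j ≤ k ^ 2 →
      ¬ ∀ d : ℤ, 0 ≤ d → (shiftPow θ (c i) ((⇑Φ)^[i] x) : ℤ → A) d =
        (shiftPow θ (c j) ((⇑Φ)^[j] x) : ℤ → A) d := by
    intro i j hij hj h
    have hT : ∀ a n : ℤ, Function.Commute (shiftPow θ a) (shiftPow θ n) := fun a n z => by
      rw [shiftPow_shiftPow, shiftPow_shiftPow, add_comm]
    have heq := eq_of_rightAsymptotic hp hθ ((continuous_shiftPow θ (c i)).comp (hcont i))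
      ((continuous_shiftPow θ (c j)).comp (hcont j)) (fun n => (hT _ n).comp_left (hcomm i n))
      (fun n => (hT _ n).comp_left (hcomm j n)) x ⟨0, h⟩
    obtain ⟨w, hw⟩ := hno (j - i) (by omega) (by omega) (-c j + c i)
    obtain ⟨z, rfl⟩ := Φ.surjective.iterate i w
    have hz := congrArg (shiftPow θ (-c j)) (congrFun heq z)
    simp only [Function.comp_apply, shiftPow_shiftPow, neg_add_cancel, shiftPow_zero] at hz
    rw [← Function.iterate_add_apply, Nat.sub_add_cancel hij.le, ← hz] at hw
    exact hw rfl
  have := card_asymptotic_pairs_le hθ hp hinf (ι := Fin (k ^ 2 + 1))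
    (fun i => (shiftPow θ (c i) ((⇑Φ)^[(i : ℕ)] x) : ℤ → A))
    (fun i => (shiftPow θ (c i) ((⇑Φ)^[(i : ℕ)] y) : ℤ → A))
    (fun i => Subtype.coe_prop _) (fun i => Subtype.coe_prop _) (fun i => hc i) (fun i => hc' i)
    (fun i j hij => by
      by_contra! h
      rcases lt_or_gt_of_ne (Fin.val_ne_of_ne hij) with hlt | hgt
      · exact htail i j hlt (by omega) h
      · exact htail j i hgt (by omega) fun d hd => (h d hd).symm)
  rw [Fintype.card_fin, hcard] at this
  omega
end
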